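/- arXiv:1410.1540 — 3 statements merged into one kernel-verified Lean document; each statement's English description precedes it below -/
import Mathlib

section
/- Ruskai's characterization of the saturation of strong subadditivity. Let ρ be a positive definite density matrix on ℂ^a ⊗ ℂ^b ⊗ ℂ^c (indexed by triples), with marginals ρ_AB = tr_C ρ, ρ_BC = tr_A ρ, ρ_B = tr_{AC} ρ (all positive definite). Then the conditional mutual information vanishes, I(A:C|B)_ρ = S(ρ_AB) + S(ρ_BC) − S(ρ_B) − S(ρ) = 0, if and only if log ρ = (log ρ_AB) ⊗ I_C + I_A ⊗ (log ρ_BC) − I_A ⊗ (log ρ_B) ⊗ I_C, where each logarithm acts on the indicated factors tensored with the identity on the remaining factors. -/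
noncomputable section
open Matrix
open scoped Classical ComplexOrder

/-- Matrix logarithm of a Hermitian matrix via the spectral decomposition
(junk value `0` on non-Hermitian input). -/
def mlog {n : Type*} [Fintype n] [DecidableEq n] (P : Matrix n n ℂ) : Matrix n n ℂ :=
  if h : P.IsHermitian then
    (h.eigenvectorUnitary : Matrix n n ℂ) *
      Matrix.diagonal (fun i => (Real.log (h.eigenvalues i) : ℂ)) *
      star (h.eigenvectorUnitary : Matrix n n ℂ)
  else 0

/-- von Neumann entropy `S(ρ) = −Σᵢ λᵢ log λᵢ` (junk value `0` on non-Hermitian input). -/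
def vN {n : Type*} [Fintype n] [DecidableEq n] (ρ : Matrix n n ℂ) : ℝ :=
  if h : ρ.IsHermitian then -∑ i, (h.eigenvalues i) * Real.log (h.eigenvalues i) else 0

/-- partial trace over the third factor `C`: `ρ_AB`. -/
def ptC {A B C : Type*} [Fintype C] (M : Matrix (A × B × C) (A × B × C) ℂ) :
    Matrix (A × B) (A × B) ℂ :=
  Matrix.of fun p q => ∑ c, M (p.1, p.2, c) (q.1, q.2, c)

/-- partial trace over the first factor `A`: `ρ_BC`. -/
def ptA {A B C : Type*} [Fintype A] (M : Matrix (A × B × C) (A × B × C) ℂ) :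
    Matrix (B × C) (B × C) ℂ :=
  Matrix.of fun p q => ∑ a, M (a, p) (a, q)

/-- partial trace over the first and third factors: `ρ_B`. -/
def ptAC {A B C : Type*} [Fintype A] [Fintype C] (M : Matrix (A × B × C) (A × B × C) ℂ) :
    Matrix B B ℂ :=
  Matrix.of fun b b' => ∑ a, ∑ c, M (a, b, c) (a, b', c)

/-- `X ⊗ I_C` : a matrix on `A ⊗ B` regarded as a matrix on `A ⊗ B ⊗ C`. -/
def embAB {A B C : Type*} (X : Matrix (A × B) (A × B) ℂ) :
    Matrix (A × B × C) (A × B × C) ℂ :=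
  Matrix.of fun p q => X (p.1, p.2.1) (q.1, q.2.1) * (if p.2.2 = q.2.2 then 1 else 0)

/-- `I_A ⊗ Y` : a matrix on `B ⊗ C` regarded as a matrix on `A ⊗ B ⊗ C`. -/
def embBC {A B C : Type*} (Y : Matrix (B × C) (B × C) ℂ) :
    Matrix (A × B × C) (A × B × C) ℂ :=
  Matrix.of fun p q => (if p.1 = q.1 then 1 else 0) * Y p.2 q.2

/-- `I_A ⊗ Z ⊗ I_C` : a matrix on `B` regarded as a matrix on `A ⊗ B ⊗ C`. -/
def embB {A B C : Type*} (Z : Matrix B B ℂ) :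
    Matrix (A × B × C) (A × B × C) ℂ :=
  Matrix.of fun p q =>
    (if p.1 = q.1 then 1 else 0) * Z p.2.1 q.2.1 * (if p.2.2 = q.2.2 then 1 else 0)


/-- If the Stieltjes-type sums `∑ w / (x + t)` dominate pointwise in `t`, then integrating over `t`
compares the corresponding logarithmic sums. -/
lemma sum_mul_log_le_of_sum_div_le {ι κ : Type*} [Fintype ι] [Fintype κ]
    {w x : ι → ℝ} {w' x' : κ → ℝ} (hx : ∀ i, 0 < x i) (hx' : ∀ k, 0 < x' k)
    (hw : ∑ i, w i = ∑ k, w' k)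
    (h : ∀ t, 0 < t → ∑ k, w' k / (x' k + t) ≤ ∑ i, w i / (x i + t)) :
    ∑ i, w i * Real.log (x i) ≤ ∑ k, w' k * Real.log (x' k) := by
  let g : ℝ → ℝ := fun t =>
    ∑ i, w i * Real.log (x i + t) - ∑ k, w' k * Real.log (x' k + t)
  have hderiv : ∀ t, 0 ≤ t →
      HasDerivAt g (∑ i, w i / (x i + t) - ∑ k, w' k / (x' k + t)) t := by
    intro t ht
    refine HasDerivAt.sub (HasDerivAt.fun_sum fun i _ => ?_) (HasDerivAt.fun_sum fun k _ => ?_)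
    · have := (((hasDerivAt_id t).const_add (x i)).log
        (by have := hx i; simp only [id]; positivity)).const_mul (w i)
      simpa [div_eq_mul_inv] using this
    · have := (((hasDerivAt_id t).const_add (x' k)).log
        (by have := hx' k; simp only [id]; positivity)).const_mul (w' k)
      simpa [div_eq_mul_inv] using this
  have hmono : MonotoneOn g (Set.Ici 0) := by
    refine monotoneOn_of_deriv_nonneg (convex_Ici 0)
      (fun t ht => (hderiv t ht).continuousAt.continuousWithinAt)
      (fun t ht => ?_) (fun t ht => ?_)
    · rw [interior_Ici] at ht
      exact (hderiv t (le_of_lt ht)).differentiableAt.differentiableWithinAt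
    · rw [interior_Ici] at ht
      rw [(hderiv t (le_of_lt ht)).deriv]
      exact sub_nonneg.2 (h t ht)
  have hg : ∀ t, g t = ∑ i, w i * (Real.log (t + x i) - Real.log t)
      - ∑ k, w' k * (Real.log (t + x' k) - Real.log t) := by
    intro t
    simp only [g, mul_sub, Finset.sum_sub_distrib, ← Finset.sum_mul, hw, add_comm t]
    ring
  have hlim : Filter.Tendsto g Filter.atTop (nhds 0) := by
    have h1 : Filter.Tendsto (fun t => ∑ i, w i * (Real.log (t + x i) - Real.log t)
        - ∑ k, w' k * (Real.log (t + x' k) - Real.log t)) Filter.atTop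
        (nhds (∑ i, w i * 0 - ∑ k, w' k * 0)) :=
      (tendsto_finsetSum _ fun i _ => (Real.tendsto_log_comp_add_sub_log (x i)).const_mul _).sub
        (tendsto_finsetSum _ fun k _ => (Real.tendsto_log_comp_add_sub_log (x' k)).const_mul _)
    simpa [← hg] using h1
  have h0 : g 0 ≤ 0 := by
    refine ge_of_tendsto hlim ?_
    filter_upwards [Filter.eventually_ge_atTop 0] with t ht
    exact hmono (Set.mem_Ici.2 le_rfl) ht ht
  simpa [g] using h0

lemma mlog_eq_cfc {n : Type*} [Fintype n] [DecidableEq n] {P : Matrix n n ℂ}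
    (hP : P.IsHermitian) : mlog P = cfc Real.log P := by
  rw [hP.cfc_eq, mlog, dif_pos hP]
  rfl

/-- The squared moduli `|⟨vᵢ, uⱼ⟩|²` of the overlaps of the eigenbases of two Hermitian matrices. -/
def overlap {n : Type*} [Fintype n] [DecidableEq n] {σ ρ : Matrix n n ℂ}
    (hσ : σ.IsHermitian) (hρ : ρ.IsHermitian) (i j : n) : ℝ :=
  Complex.normSq ((star (hσ.eigenvectorUnitary : Matrix n n ℂ) * hρ.eigenvectorUnitary) i j)

section Spectral

variable {n : Type*} [Fintype n] [DecidableEq n] {σ ρ : Matrix n n ℂ}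

lemma overlap_nonneg (hσ : σ.IsHermitian) (hρ : ρ.IsHermitian) (i j : n) :
    0 ≤ overlap hσ hρ i j :=
  Complex.normSq_nonneg _

lemma overlap_self (hρ : ρ.IsHermitian) (i j : n) :
    overlap hρ hρ i j = if i = j then 1 else 0 := by
  rw [overlap, Unitary.coe_star_mul_self, Matrix.one_apply]
  split_ifs <;> simp

lemma cfc_eq_mul_diagonal_mul (hρ : ρ.IsHermitian) (f : ℝ → ℝ) :
    cfc f ρ = (hρ.eigenvectorUnitary : Matrix n n ℂ) *
      Matrix.diagonal (fun i => (f (hρ.eigenvalues i) : ℂ)) *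
      star (hρ.eigenvectorUnitary : Matrix n n ℂ) := by
  rw [hρ.cfc_eq]
  rfl

lemma re_trace_cfc_mul_cfc (hσ : σ.IsHermitian) (hρ : ρ.IsHermitian) (g f : ℝ → ℝ) :
    (trace (cfc g σ * cfc f ρ)).re =
      ∑ i, ∑ j, overlap hσ hρ i j * (g (hσ.eigenvalues i) * f (hρ.eigenvalues j)) := by
  rw [cfc_eq_mul_diagonal_mul hσ, cfc_eq_mul_diagonal_mul hρ]
  set V := (hσ.eigenvectorUnitary : Matrix n n ℂ)
  set U := (hρ.eigenvectorUnitary : Matrix n n ℂ)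
  set S := Matrix.diagonal (fun i => (g (hσ.eigenvalues i) : ℂ))
  set R := Matrix.diagonal (fun i => (f (hρ.eigenvalues i) : ℂ))
  have h1 : trace (V * S * star V * (U * R * star U))
      = trace ((S * (star V * U)) * (R * star (star V * U))) := by
    rw [show V * S * star V * (U * R * star U)
      = V * (S * (star V * U) * (R * star U)) by simp only [Matrix.mul_assoc],
      Matrix.trace_mul_comm, star_mul, star_star]
    simp only [Matrix.mul_assoc]
  rw [h1, Matrix.trace, Complex.re_sum]
  refine Finset.sum_congr rfl fun i _ => ?_
  rw [Matrix.diag_apply, Matrix.mul_apply, Complex.re_sum]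
  refine Finset.sum_congr rfl fun j _ => ?_
  simp only [S, R, Matrix.diagonal_mul, Matrix.star_apply, overlap]
  change (_ * (_ * (starRingEnd ℂ) ((star V * U) i j))).re = Complex.normSq ((star V * U) i j) * _
  rw [mul_mul_mul_comm, Complex.mul_conj, ← Complex.ofReal_mul, ← Complex.ofReal_mul,
    Complex.ofReal_re, mul_comm]

lemma re_trace_mul_mlog (hρ : ρ.IsHermitian) : (trace (ρ * mlog ρ)).re = -vN ρ := by
  have h := re_trace_cfc_mul_cfc hρ hρ id Real.log
  rw [cfc_id ℝ ρ hρ.isSelfAdjoint, ← mlog_eq_cfc hρ] at h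
  rw [h, vN, dif_pos hρ]
  simp [overlap_self]


/-- Umegaki's relative entropy `tr ρ (log ρ - log σ)`. -/
def relEnt (ρ σ : Matrix n n ℂ) : ℝ := (trace (ρ * (mlog ρ - mlog σ))).re

lemma re_trace_eq_sum_overlap_left (hσ : σ.IsHermitian) (hρ : ρ.IsHermitian) :
    (trace σ).re = ∑ i, ∑ j, overlap hσ hρ i j * hσ.eigenvalues i := by
  have h := re_trace_cfc_mul_cfc hσ hρ id (fun _ => 1)
  rw [cfc_id ℝ σ hσ.isSelfAdjoint, cfc_const_one ℝ ρ hρ.isSelfAdjoint, mul_one] at h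
  simpa using h

lemma re_trace_eq_sum_overlap_right (hσ : σ.IsHermitian) (hρ : ρ.IsHermitian) :
    (trace ρ).re = ∑ i, ∑ j, overlap hσ hρ i j * hρ.eigenvalues j := by
  have h := re_trace_cfc_mul_cfc hσ hρ (fun _ => 1) id
  rw [cfc_id ℝ ρ hρ.isSelfAdjoint, cfc_const_one ℝ σ hσ.isSelfAdjoint, one_mul] at h
  simpa using h

lemma relEnt_eq_neg_vN_sub (hρ : ρ.IsHermitian) (σ : Matrix n n ℂ) :
    relEnt ρ σ = -vN ρ - (trace (ρ * mlog σ)).re := by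
  rw [relEnt, Matrix.mul_sub, Matrix.trace_sub, Complex.sub_re, re_trace_mul_mlog hρ]

lemma relEnt_eq_sum_overlap (hσ : σ.IsHermitian) (hρ : ρ.IsHermitian) :
    relEnt ρ σ = ∑ i, ∑ j, overlap hσ hρ i j *
      (hρ.eigenvalues j * (Real.log (hρ.eigenvalues j) - Real.log (hσ.eigenvalues i))) := by
  have h1 := re_trace_cfc_mul_cfc hσ hρ (fun _ => 1) (fun x => x * Real.log x)
  have h2 := re_trace_cfc_mul_cfc hσ hρ Real.log id
  rw [cfc_const_one ℝ σ hσ.isSelfAdjoint, one_mul,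
    cfc_mul (fun x => x) Real.log ρ (by fun_prop)
      (by rw [continuousOn_iff_continuous_domRestrict]; fun_prop),
    cfc_id' ℝ ρ hρ.isSelfAdjoint, ← mlog_eq_cfc hρ] at h1
  rw [cfc_id ℝ ρ hρ.isSelfAdjoint, ← mlog_eq_cfc hσ, Matrix.trace_mul_comm] at h2
  rw [relEnt, Matrix.mul_sub, Matrix.trace_sub, Complex.sub_re, h1, h2]
  simp only [← Finset.sum_sub_distrib]
  refine Finset.sum_congr rfl fun i _ => Finset.sum_congr rfl fun j _ => ?_
  simp only [id]
  ring

/-- Klein's inequality. -/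
lemma trace_sub_trace_le_relEnt (hρ : ρ.PosDef) (hσ : σ.PosDef) :
    (trace ρ).re - (trace σ).re ≤ relEnt ρ σ := by
  rw [re_trace_eq_sum_overlap_left hσ.1 hρ.1, re_trace_eq_sum_overlap_right hσ.1 hρ.1,
    relEnt_eq_sum_overlap hσ.1 hρ.1]
  simp only [← Finset.sum_sub_distrib, ← mul_sub]
  refine Finset.sum_le_sum fun i _ => Finset.sum_le_sum fun j _ =>
    mul_le_mul_of_nonneg_left ?_ (overlap_nonneg _ _ _ _)
  have hr := hρ.eigenvalues_pos j
  have hs := hσ.eigenvalues_pos i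
  have h := Real.log_le_sub_one_of_pos (div_pos hs hr)
  rw [Real.log_div hs.ne' hr.ne'] at h
  have h' := mul_le_mul_of_nonneg_left h hr.le
  rw [mul_sub, mul_sub, mul_div_cancel₀ _ hr.ne'] at h'
  linarith

/-- The relative entropy is bounded by the `χ²`-divergence. -/
lemma relEnt_le_trace_cfc_inv (hρ : ρ.PosDef) (hσ : σ.PosDef) :
    relEnt ρ σ ≤ (trace (cfc (fun x : ℝ => x⁻¹) σ * (ρ * ρ))).re - (trace ρ).re := by
  have h1 := re_trace_cfc_mul_cfc hσ.1 hρ.1 (fun x => x⁻¹) (fun x => x * x)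
  rw [cfc_mul (fun x => x) (fun x => x) ρ (by fun_prop) (by fun_prop),
    cfc_id' ℝ ρ hρ.1.isSelfAdjoint] at h1
  rw [h1, re_trace_eq_sum_overlap_right hσ.1 hρ.1, relEnt_eq_sum_overlap hσ.1 hρ.1]
  simp only [← Finset.sum_sub_distrib, ← mul_sub]
  refine Finset.sum_le_sum fun i _ => Finset.sum_le_sum fun j _ =>
    mul_le_mul_of_nonneg_left ?_ (overlap_nonneg _ _ _ _)
  have hr := hρ.eigenvalues_pos j
  have hs := hσ.eigenvalues_pos i
  have h := Real.log_le_sub_one_of_pos (div_pos hr hs)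
  rw [Real.log_div hr.ne' hs.ne'] at h
  refine (mul_le_mul_of_nonneg_left h hr.le).trans (le_of_eq ?_)
  ring

lemma cfc_inv_mul_self (hσ : σ.PosDef) : cfc (fun x : ℝ => x⁻¹) σ * σ = 1 := by
  have hc : ∀ f : ℝ → ℝ, ContinuousOn f (spectrum ℝ σ) := fun f => by
    rw [continuousOn_iff_continuous_domRestrict]; fun_prop
  nth_rewrite 2 [← cfc_id' ℝ σ hσ.1.isSelfAdjoint]
  rw [← cfc_mul _ _ σ (hc _) (hc _), ← cfc_const_one ℝ σ hσ.1.isSelfAdjoint]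
  refine cfc_congr fun x hx => ?_
  rw [hσ.1.spectrum_real_eq_range_eigenvalues] at hx
  obtain ⟨i, rfl⟩ := hx
  exact inv_mul_cancel₀ (hσ.eigenvalues_pos i).ne'

lemma relEnt_add_smul_le (hσ : σ.PosDef) (H : Matrix n n ℂ) (t : ℝ)
    (ht : (σ + t • H).PosDef) :
    relEnt (σ + t • H) σ ≤ t * (trace H).re +
      t ^ 2 * (trace (cfc (fun x : ℝ => x⁻¹) σ * (H * H))).re := by
  refine (relEnt_le_trace_cfc_inv ht hσ).trans (le_of_eq ?_)
  have hinv := cfc_inv_mul_self hσ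
  have hinv' : σ * cfc (fun x : ℝ => x⁻¹) σ = 1 := mul_eq_one_comm.1 hinv
  set R := cfc (fun x : ℝ => x⁻¹) σ
  have e : R * ((σ + t • H) * (σ + t • H)) =
      σ + t • H + t • (R * (H * σ)) + (t ^ 2) • (R * (H * H)) := by
    have h1 : R * (σ * σ) = σ := by rw [← mul_assoc, hinv, one_mul]
    have h2 : R * (σ * H) = H := by rw [← mul_assoc, hinv, one_mul]
    simp only [mul_add, add_mul, smul_mul_assoc, mul_smul_comm, h1, h2, smul_add, smul_smul, sq]
    abel
  have h3 : trace (R * (H * σ)) = trace H := by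
    rw [← mul_assoc, Matrix.trace_mul_comm, ← mul_assoc, hinv', one_mul]
  rw [e]
  simp only [Matrix.trace_add, Matrix.trace_smul, h3, Complex.add_re, Complex.real_smul,
    Complex.re_ofReal_mul]
  ring

/-- The quadratic functional whose supremum over `X` is the quasi-entropy `quasiEnt`. -/
def quasiForm (ρ σ : Matrix n n ℂ) (t : ℝ) (X : Matrix n n ℂ) : ℝ :=
  2 * (trace (Xᴴ * ρ)).re - (trace (X * Xᴴ * σ)).re - t * (trace (Xᴴ * X * ρ)).re

/-- The quasi-entropy `⟨ρ, (L_σ + t R_ρ)⁻¹ ρ⟩` in spectral coordinates. -/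
def quasiEnt (hσ : σ.IsHermitian) (hρ : ρ.IsHermitian) (t : ℝ) : ℝ :=
  ∑ i, ∑ j, overlap hσ hρ i j * hρ.eigenvalues j /
    (hσ.eigenvalues i / hρ.eigenvalues j + t)

lemma quasiForm_eq_sum (hσ : σ.IsHermitian) (hρ : ρ.IsHermitian) (t : ℝ) (Y : Matrix n n ℂ) :
    quasiForm ρ σ t (hσ.eigenvectorUnitary * Y * star (hρ.eigenvectorUnitary : Matrix n n ℂ)) =
      ∑ i, ∑ j, (2 * (star (Y i j) *
          (star (hσ.eigenvectorUnitary : Matrix n n ℂ) * hρ.eigenvectorUnitary) i j).re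
            * hρ.eigenvalues j
        - (hσ.eigenvalues i + t * hρ.eigenvalues j) * Complex.normSq (Y i j)) := by
  have hS := cfc_eq_mul_diagonal_mul hσ id
  have hR := cfc_eq_mul_diagonal_mul hρ id
  rw [cfc_id ℝ σ hσ.isSelfAdjoint] at hS
  rw [cfc_id ℝ ρ hρ.isSelfAdjoint] at hR
  have hV : star (hσ.eigenvectorUnitary : Matrix n n ℂ) * hσ.eigenvectorUnitary = 1 :=
    Unitary.coe_star_mul_self _
  have hU : star (hρ.eigenvectorUnitary : Matrix n n ℂ) * hρ.eigenvectorUnitary = 1 :=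
    Unitary.coe_star_mul_self _
  set V := (hσ.eigenvectorUnitary : Matrix n n ℂ)
  set U := (hρ.eigenvectorUnitary : Matrix n n ℂ)
  set S := Matrix.diagonal (fun i => ((id (hσ.eigenvalues i) : ℝ) : ℂ)) with hSd
  set R := Matrix.diagonal (fun i => ((id (hρ.eigenvalues i) : ℝ) : ℂ)) with hRd
  have hX : (V * Y * star U)ᴴ = U * star Y * star V := by
    simp only [← Matrix.star_eq_conjTranspose, star_mul, star_star, mul_assoc]
  have e1 : trace ((V * Y * star U)ᴴ * ρ) = trace (star Y * (star V * U * R)) := by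
    rw [hX, hR, show U * star Y * star V * (U * R * star U)
      = U * (star Y * (star V * U * R) * star U) by simp only [mul_assoc],
      Matrix.trace_mul_comm, mul_assoc, hU, mul_one]
  have e2 : trace (V * Y * star U * (V * Y * star U)ᴴ * σ) = trace (Y * (star Y * S)) := by
    rw [hX, hS, show V * Y * star U * (U * star Y * star V) * (V * S * star V)
      = V * (Y * (star U * U) * (star Y * (star V * V) * S) * star V) by simp only [mul_assoc],
      Matrix.trace_mul_comm, hU, hV, mul_one, mul_one, mul_assoc, hV, mul_one]
  have e3 : trace ((V * Y * star U)ᴴ * (V * Y * star U) * ρ) = trace (star Y * (Y * R)) := by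
    rw [hX, hR, show U * star Y * star V * (V * Y * star U) * (U * R * star U)
      = U * (star Y * (star V * V) * (Y * (star U * U) * R) * star U) by simp only [mul_assoc],
      Matrix.trace_mul_comm, hU, hV, mul_one, mul_one, mul_assoc, hU, mul_one]
  have key : ∀ Z : Matrix n n ℂ, (trace (star Y * Z)).re = ∑ i, ∑ j, (star (Y i j) * Z i j).re := by
    intro Z
    simp only [Matrix.trace, Matrix.diag_apply, Matrix.mul_apply, Matrix.star_apply,
      Complex.re_sum]
    exact Finset.sum_comm
  have hnorm : ∀ z : ℂ, (star z * z).re = Complex.normSq z := by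
    intro z
    rw [mul_comm, Complex.star_def, Complex.mul_conj, Complex.ofReal_re]
  have hnorm' : ∀ (z : ℂ) (r : ℝ), (star z * ((r : ℂ) * z)).re = r * Complex.normSq z := by
    intro z r
    rw [mul_left_comm, Complex.re_ofReal_mul, hnorm]
  have e2' : trace (Y * (star Y * S)) = trace (star Y * (S * Y)) := by
    rw [Matrix.trace_mul_comm, mul_assoc]
  rw [quasiForm, e1, e2, e3, e2', key, key, key]
  simp only [hSd, hRd, Matrix.mul_diagonal, Matrix.diagonal_mul, hnorm, hnorm', id,
    ← mul_assoc _ _ (Complex.ofReal _), Complex.re_mul_ofReal, Finset.mul_sum,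
    ← Finset.sum_sub_distrib]
  refine Finset.sum_congr rfl fun i _ => Finset.sum_congr rfl fun j _ => ?_
  ring

lemma quasiForm_le_quasiEnt (hρ : ρ.PosDef) (hσ : σ.PosDef) {t : ℝ} (ht : 0 < t)
    (X : Matrix n n ℂ) : quasiForm ρ σ t X ≤ quasiEnt hσ.1 hρ.1 t := by
  have hX : X = hσ.1.eigenvectorUnitary *
      (star (hσ.1.eigenvectorUnitary : Matrix n n ℂ) * X * hρ.1.eigenvectorUnitary) *
      star (hρ.1.eigenvectorUnitary : Matrix n n ℂ) := by
    have hV : (hσ.1.eigenvectorUnitary : Matrix n n ℂ) * star hσ.1.eigenvectorUnitary.1 = 1 :=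
      Unitary.coe_mul_star_self _
    have hU : (hρ.1.eigenvectorUnitary : Matrix n n ℂ) * star hρ.1.eigenvectorUnitary.1 = 1 :=
      Unitary.coe_mul_star_self _
    rw [← mul_assoc, ← mul_assoc, hV, one_mul, mul_assoc, hU, mul_one]
  rw [hX, quasiForm_eq_sum, quasiEnt]
  refine Finset.sum_le_sum fun i _ => Finset.sum_le_sum fun j _ => ?_
  have hr := hρ.eigenvalues_pos j
  have hs := hσ.eigenvalues_pos i
  rw [overlap]
  set y := (star (hσ.1.eigenvectorUnitary : Matrix n n ℂ) * X * hρ.1.eigenvectorUnitary) i j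
  set z := (star (hσ.1.eigenvectorUnitary : Matrix n n ℂ) * hρ.1.eigenvectorUnitary) i j
  set r := hρ.1.eigenvalues j
  set s := hσ.1.eigenvalues i
  have hk : 0 < s + t * r := by positivity
  have e : Complex.normSq z * r / (s / r + t) = Complex.normSq z * r ^ 2 / (s + t * r) := by
    field_simp
  rw [e, le_div_iff₀ hk]
  simp only [Complex.normSq_apply, Complex.star_def, Complex.mul_re, Complex.conj_re,
    Complex.conj_im]
  nlinarith [sq_nonneg (z.re * r - (s + t * r) * y.re), sq_nonneg (z.im * r - (s + t * r) * y.im)]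

lemma exists_quasiForm_eq_quasiEnt (hρ : ρ.PosDef) (hσ : σ.PosDef) {t : ℝ} (ht : 0 < t) :
    ∃ X, quasiForm ρ σ t X = quasiEnt hσ.1 hρ.1 t := by
  refine ⟨hσ.1.eigenvectorUnitary * (Matrix.of fun i j =>
    ((hρ.1.eigenvalues j / (hσ.1.eigenvalues i + t * hρ.1.eigenvalues j) : ℝ) : ℂ) *
      (star (hσ.1.eigenvectorUnitary : Matrix n n ℂ) * hρ.1.eigenvectorUnitary) i j) *
    star (hρ.1.eigenvectorUnitary : Matrix n n ℂ), ?_⟩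
  rw [quasiForm_eq_sum, quasiEnt]
  refine Finset.sum_congr rfl fun i _ => Finset.sum_congr rfl fun j _ => ?_
  have hr := hρ.eigenvalues_pos j
  have hs := hσ.eigenvalues_pos i
  rw [overlap, Matrix.of_apply]
  set z := (star (hσ.1.eigenvectorUnitary : Matrix n n ℂ) * hρ.1.eigenvectorUnitary) i j
  set r := hρ.1.eigenvalues j
  set s := hσ.1.eigenvalues i
  have hk : 0 < s + t * r := by positivity
  have e : (star (((r / (s + t * r) : ℝ) : ℂ) * z) * z).re
      = r / (s + t * r) * Complex.normSq z := by
    rw [Complex.star_def, map_mul, Complex.conj_ofReal, mul_assoc, Complex.re_ofReal_mul, mul_comm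
      _ z, Complex.mul_conj, Complex.ofReal_re]
  rw [e, Complex.normSq_mul, Complex.normSq_ofReal]
  field_simp
  ring

end Spectral

section Monotonicity

variable {m n : Type*} [Fintype m] [DecidableEq m] [Fintype n] [DecidableEq n]

/-- Monotonicity of the relative entropy under the restriction of states to a subalgebra. -/
lemma relEnt_le_relEnt_of_starAlgHom (E : Matrix m m ℂ →⋆ₐ[ℂ] Matrix n n ℂ)
    {ρ σ : Matrix n n ℂ} {ρ' σ' : Matrix m m ℂ} (hρ : ρ.PosDef) (hσ : σ.PosDef)
    (hρ' : ρ'.PosDef) (hσ' : σ'.PosDef) (h1 : ∀ X, trace (E X * ρ) = trace (X * ρ'))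
    (h2 : ∀ X, trace (E X * σ) = trace (X * σ')) : relEnt ρ' σ' ≤ relEnt ρ σ := by
  have hquasi : ∀ t, 0 < t → quasiEnt hσ'.1 hρ'.1 t ≤ quasiEnt hσ.1 hρ.1 t := by
    intro t ht
    obtain ⟨X, hX⟩ := exists_quasiForm_eq_quasiEnt hρ' hσ' ht
    rw [← hX]
    refine le_trans (le_of_eq ?_) (quasiForm_le_quasiEnt hρ hσ ht (E X))
    simp only [quasiForm, ← Matrix.star_eq_conjTranspose, ← map_star, ← map_mul, h1, h2]
  have htr : (trace ρ).re = (trace ρ').re := by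
    have := h1 1
    rw [map_one, one_mul, one_mul] at this
    rw [this]
  have hcmp := sum_mul_log_le_of_sum_div_le
    (w := fun p : n × n => overlap hσ.1 hρ.1 p.1 p.2 * hρ.1.eigenvalues p.2)
    (x := fun p : n × n => hσ.1.eigenvalues p.1 / hρ.1.eigenvalues p.2)
    (w' := fun p : m × m => overlap hσ'.1 hρ'.1 p.1 p.2 * hρ'.1.eigenvalues p.2)
    (x' := fun p : m × m => hσ'.1.eigenvalues p.1 / hρ'.1.eigenvalues p.2)
    (fun p => div_pos (hσ.eigenvalues_pos _) (hρ.eigenvalues_pos _))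
    (fun p => div_pos (hσ'.eigenvalues_pos _) (hρ'.eigenvalues_pos _))
    (by
      simp only [Fintype.sum_prod_type]
      rw [← re_trace_eq_sum_overlap_right, ← re_trace_eq_sum_overlap_right, htr])
    (fun t ht => by
      simp only [Fintype.sum_prod_type]
      exact hquasi t ht)
  rw [relEnt_eq_sum_overlap hσ.1 hρ.1, relEnt_eq_sum_overlap hσ'.1 hρ'.1, ← neg_le_neg_iff]
  convert hcmp using 1 <;>
  · rw [Fintype.sum_prod_type]
    simp only [← Finset.sum_neg_distrib]
    refine Finset.sum_congr rfl fun i _ => Finset.sum_congr rfl fun j _ => ?_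
    rw [Real.log_div (by exact (PosDef.eigenvalues_pos ‹_› i).ne')
      (by exact (PosDef.eigenvalues_pos ‹_› j).ne')]
    ring

/-- The logarithm of a Hermitian matrix commutes with star algebra homomorphisms. -/
lemma mlog_starAlgHom_apply (E : Matrix m m ℂ →⋆ₐ[ℂ] Matrix n n ℂ) {P : Matrix m m ℂ}
    (hP : P.IsHermitian) : mlog (E P) = E (mlog P) := by
  have hE : (E P).IsHermitian := by
    rw [Matrix.IsHermitian, ← Matrix.star_eq_conjTranspose, ← map_star,
      Matrix.star_eq_conjTranspose, hP]
  rw [mlog_eq_cfc hP, mlog_eq_cfc hE]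
  refine (StarAlgHom.map_cfc E Real.log P ?_ ?_ hP.isSelfAdjoint hE.isSelfAdjoint).symm
  · rw [continuousOn_iff_continuous_domRestrict]
    fun_prop
  · exact LinearMap.continuous_of_finiteDimensional
      (E : Matrix m m ℂ →ₐ[ℂ] Matrix n n ℂ).toLinearMap

open scoped Kronecker

/-- The embedding `Y ↦ 1 ⊗ Y` as a star algebra homomorphism. -/
def oneKroneckerHom (m n : Type*) [Fintype m] [DecidableEq m] [Fintype n] [DecidableEq n] :
    Matrix n n ℂ →⋆ₐ[ℂ] Matrix (m × n) (m × n) ℂ where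
  toFun Y := 1 ⊗ₖ Y
  map_one' := Matrix.one_kronecker_one
  map_mul' X Y := by rw [← Matrix.mul_kronecker_mul, one_mul]
  map_zero' := Matrix.kronecker_zero _
  map_add' := Matrix.kronecker_add _
  commutes' r := by
    simp only [Algebra.algebraMap_eq_smul_one, Matrix.kronecker_smul, Matrix.one_kronecker_one]
  map_star' Y := by
    simp only [Matrix.star_eq_conjTranspose, Matrix.conjTranspose_kronecker,
      Matrix.conjTranspose_one]

lemma oneKroneckerHom_apply (Y : Matrix n n ℂ) : oneKroneckerHom m n Y = 1 ⊗ₖ Y := rfl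

lemma posDef_oneKroneckerHom {Y : Matrix n n ℂ} (hY : Y.PosDef) :
    (oneKroneckerHom m n Y).PosDef :=
  Matrix.PosDef.one.kronecker hY

end Monotonicity

section PartialTrace

variable {A B C : Type*}

lemma trace_embAB_mul [Fintype A] [Fintype B] [Fintype C] (X : Matrix (A × B) (A × B) ℂ)
    (M : Matrix (A × B × C) (A × B × C) ℂ) :
    trace (embAB X * M) = trace (X * ptC M) := by
  simp only [embAB, ptC, Matrix.trace, Matrix.diag_apply, Matrix.mul_apply, Matrix.of_apply,
    Fintype.sum_prod_type, mul_ite, mul_one, mul_zero, ite_mul, zero_mul, Finset.sum_ite_eq,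
    Finset.mem_univ, if_true, Finset.mul_sum]
  refine Finset.sum_congr rfl fun a _ => Finset.sum_congr rfl fun b _ => ?_
  rw [Finset.sum_comm]
  refine Finset.sum_congr rfl fun a' _ => Finset.sum_comm

lemma trace_embBC_mul [Fintype A] [Fintype B] [Fintype C] (Y : Matrix (B × C) (B × C) ℂ)
    (M : Matrix (A × B × C) (A × B × C) ℂ) :
    trace (embBC Y * M) = trace (Y * ptA M) := by
  simp only [embBC, ptA, Matrix.trace, Matrix.diag_apply, Matrix.mul_apply, Matrix.of_apply,
    Fintype.sum_prod_type (α₁ := A), ite_mul, one_mul, zero_mul, Finset.mul_sum]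
  rw [Finset.sum_comm]
  refine Finset.sum_congr rfl fun p _ => ?_
  rw [Finset.sum_comm (s := Finset.univ (α := B × C))]
  refine Finset.sum_congr rfl fun a _ => ?_
  rw [Finset.sum_comm]
  simp

lemma trace_embB_mul [Fintype A] [Fintype B] [Fintype C] (Z : Matrix B B ℂ)
    (M : Matrix (A × B × C) (A × B × C) ℂ) :
    trace (embB Z * M) = trace (Z * ptAC M) := by
  simp only [embB, ptAC, Matrix.trace, Matrix.diag_apply, Matrix.mul_apply, Matrix.of_apply,
    Fintype.sum_prod_type, ite_mul, one_mul, zero_mul, Finset.mul_sum, mul_ite, mul_one, mul_zero]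
  simp only [Finset.sum_ite_eq, Finset.mem_univ, if_true, Finset.sum_ite_irrel,
    Finset.sum_const_zero]
  rw [Finset.sum_comm]
  refine Finset.sum_congr rfl fun b _ => ?_
  rw [Finset.sum_comm (s := Finset.univ (α := B))]
  refine Finset.sum_congr rfl fun a _ => Finset.sum_comm

lemma trace_ptC [Fintype A] [Fintype B] [Fintype C]
    (M : Matrix (A × B × C) (A × B × C) ℂ) :
    trace (ptC M) = trace M := by
  simp [ptC, Matrix.trace, Fintype.sum_prod_type]

lemma trace_ptA [Fintype A] [Fintype B] [Fintype C]
    (M : Matrix (A × B × C) (A × B × C) ℂ) :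
    trace (ptA M) = trace M := by
  simp only [ptA, Matrix.trace, Fintype.sum_prod_type (α₁ := A), Matrix.diag_apply,
    Matrix.of_apply]
  exact Finset.sum_comm

lemma trace_ptAC [Fintype A] [Fintype B] [Fintype C]
    (M : Matrix (A × B × C) (A × B × C) ℂ) :
    trace (ptAC M) = trace M := by
  simp only [ptAC, Matrix.trace, Fintype.sum_prod_type, Matrix.diag_apply, Matrix.of_apply]
  exact Finset.sum_comm

lemma isHermitian_embB {Z : Matrix B B ℂ} (hZ : Z.IsHermitian) :
    (embB Z : Matrix (A × B × C) (A × B × C) ℂ).IsHermitian := by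
  ext p q
  have h := congr_fun₂ hZ p.2.1 q.2.1
  rw [Matrix.conjTranspose_apply] at h
  simp only [Matrix.conjTranspose_apply, embB, Matrix.of_apply, star_mul', h,
    eq_comm (a := q.1), eq_comm (a := q.2.2)]
  split_ifs <;> simp

lemma ptC_add_smul [Fintype C] (ρ H : Matrix (A × B × C) (A × B × C) ℂ) (t : ℝ) :
    ptC (ρ + t • H) = ptC ρ + t • ptC H := by
  ext
  simp [ptC, Finset.sum_add_distrib, Finset.mul_sum]

lemma ptA_add_smul [Fintype A] (ρ H : Matrix (A × B × C) (A × B × C) ℂ) (t : ℝ) :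
    ptA (ρ + t • H) = ptA ρ + t • ptA H := by
  ext
  simp [ptA, Finset.sum_add_distrib, Finset.mul_sum]

lemma ptAC_add_smul [Fintype A] [Fintype C] (ρ H : Matrix (A × B × C) (A × B × C) ℂ) (t : ℝ) :
    ptAC (ρ + t • H) = ptAC ρ + t • ptAC H := by
  ext
  simp [ptAC, Finset.sum_add_distrib, Finset.mul_sum]

lemma isHermitian_ptC [Fintype C] {H : Matrix (A × B × C) (A × B × C) ℂ} (hH : H.IsHermitian) :
    (ptC H).IsHermitian := by
  ext p q
  simp only [ptC, Matrix.conjTranspose_apply, Matrix.of_apply, star_sum, hH.apply]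

lemma isHermitian_ptA [Fintype A] {H : Matrix (A × B × C) (A × B × C) ℂ} (hH : H.IsHermitian) :
    (ptA H).IsHermitian := by
  ext p q
  simp only [ptA, Matrix.conjTranspose_apply, Matrix.of_apply, star_sum, hH.apply]

lemma isHermitian_ptAC [Fintype A] [Fintype C] {H : Matrix (A × B × C) (A × B × C) ℂ}
    (hH : H.IsHermitian) :
    (ptAC H).IsHermitian := by
  ext p q
  simp only [ptAC, Matrix.conjTranspose_apply, Matrix.of_apply, star_sum, hH.apply]

lemma trace_embAB_mul_embBC_ptA [Fintype A] [DecidableEq A] [Fintype B] [DecidableEq B]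
    [Fintype C] (X : Matrix (A × B) (A × B) ℂ)
    (M : Matrix (A × B × C) (A × B × C) ℂ) :
    trace (embAB X * embBC (ptA M)) = trace (X * oneKroneckerHom A B (ptAC M)) := by
  rw [trace_embAB_mul]
  congr 2
  ext ⟨a, b⟩ ⟨a', b'⟩
  simp only [ptC, embBC, ptA, ptAC, oneKroneckerHom_apply, Matrix.kroneckerMap_apply,
    Matrix.of_apply, Matrix.one_apply]
  split_ifs
  · simp only [one_mul]
    exact Finset.sum_comm
  · simp

end PartialTrace

section Tripartite

variable {A B C : Type*} [Fintype A] [DecidableEq A] [Fintype B] [DecidableEq B]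
  [Fintype C] [DecidableEq C]

/-- The embedding `X ↦ X ⊗ I_C` as a star algebra homomorphism. -/
def embABHom (A B C : Type*) [Fintype A] [DecidableEq A] [Fintype B] [DecidableEq B]
    [Fintype C] [DecidableEq C] :
    Matrix (A × B) (A × B) ℂ →⋆ₐ[ℂ] Matrix (A × B × C) (A × B × C) ℂ where
  toFun := embAB
  map_one' := by
    ext ⟨a, b, c⟩ ⟨a', b', c'⟩
    simp only [embAB, Matrix.of_apply, Matrix.one_apply, Prod.mk.injEq]
    grind
  map_mul' X Y := by
    ext ⟨a, b, c⟩ ⟨a', b', c'⟩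
    simp only [embAB, Matrix.of_apply, Matrix.mul_apply, Fintype.sum_prod_type]
    simp
  map_zero' := by
    ext
    simp [embAB]
  map_add' X Y := by
    ext
    simp only [embAB, Matrix.of_apply, Matrix.add_apply, add_mul]
  commutes' r := by
    ext ⟨a, b, c⟩ ⟨a', b', c'⟩
    simp only [embAB, Matrix.of_apply, Matrix.algebraMap_matrix_apply, Prod.mk.injEq]
    grind
  map_star' X := by
    ext ⟨a, b, c⟩ ⟨a', b', c'⟩
    by_cases h : c = c' <;> simp [embAB, Matrix.star_apply, h, eq_comm]

lemma embBC_eq_oneKroneckerHom (Y : Matrix (B × C) (B × C) ℂ) :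
    embBC Y = oneKroneckerHom A (B × C) Y := by
  ext p q
  simp [embBC, oneKroneckerHom_apply, Matrix.kroneckerMap_apply, Matrix.one_apply]

/-- `tr ((1 ⊗ Z) N)` depends only on the marginal of `N`. -/
lemma trace_oneKroneckerHom_mul_ptC (Z : Matrix B B ℂ) (M : Matrix (A × B × C) (A × B × C) ℂ) :
    trace (oneKroneckerHom A B Z * ptC M) = trace (Z * ptAC M) := by
  rw [← trace_embAB_mul, ← trace_embB_mul]
  congr 2
  ext p q
  simp [embAB, embB, oneKroneckerHom_apply, Matrix.kroneckerMap_apply, Matrix.one_apply]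

/-- Strong subadditivity of the von Neumann entropy. -/
lemma vN_strong_subadditivity {M : Matrix (A × B × C) (A × B × C) ℂ} (hM : M.PosDef)
    (hAB : (ptC M).PosDef) (hBC : (ptA M).PosDef) (hB : (ptAC M).PosDef) :
    0 ≤ vN (ptC M) + vN (ptA M) - vN (ptAC M) - vN M := by
  have h := relEnt_le_relEnt_of_starAlgHom (embABHom A B C) (ρ := M)
    (σ := oneKroneckerHom A (B × C) (ptA M)) (ρ' := ptC M) (σ' := oneKroneckerHom A B (ptAC M))
    hM (posDef_oneKroneckerHom hBC) hAB (posDef_oneKroneckerHom hB)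
    (fun X => trace_embAB_mul X M)
    (fun X => by
      rw [← embBC_eq_oneKroneckerHom]
      exact trace_embAB_mul_embBC_ptA X M)
  rw [relEnt_eq_neg_vN_sub hAB.1, relEnt_eq_neg_vN_sub hM.1, mlog_starAlgHom_apply _ hBC.1,
    mlog_starAlgHom_apply _ hB.1, Matrix.trace_mul_comm, trace_oneKroneckerHom_mul_ptC,
    ← embBC_eq_oneKroneckerHom, Matrix.trace_mul_comm M, trace_embBC_mul, Matrix.trace_mul_comm,
    re_trace_mul_mlog hB.1, Matrix.trace_mul_comm (mlog (ptA M)), re_trace_mul_mlog hBC.1] at h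
  linarith

end Tripartite

lemma Matrix.PosDef.eventually_posDef_add_smul {n : Type*} [Fintype n] [DecidableEq n]
    {ρ H : Matrix n n ℂ} (hρ : ρ.PosDef) (hH : H.IsHermitian) :
    ∀ᶠ t : ℝ in nhdsWithin 0 (Set.Ioi 0), (ρ + t • H).PosDef := by
  have hcfc : ∀ {P : Matrix n n ℂ} (hP : P.IsHermitian) (f : ℝ → ℝ),
      (∀ i, 0 ≤ f (hP.eigenvalues i)) → (cfc f P).PosSemidef := by
    intro P hP f hf
    rw [cfc_eq_mul_diagonal_mul hP, Matrix.star_eq_conjTranspose]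
    refine Matrix.PosSemidef.mul_mul_conjTranspose_same (Matrix.PosSemidef.diagonal fun i => ?_) _
    simpa using hf i
  obtain ⟨ε, hε, hερ⟩ : ∃ ε : ℝ, 0 < ε ∧ ∀ i, ε ≤ hρ.1.eigenvalues i := by
    rcases isEmpty_or_nonempty n with h | h
    · exact ⟨1, one_pos, fun i => isEmptyElim i⟩
    · obtain ⟨i, hi⟩ := Finite.exists_min hρ.1.eigenvalues
      exact ⟨_, hρ.eigenvalues_pos i, hi⟩
  obtain ⟨K, hK, hKH⟩ : ∃ K : ℝ, 0 < K ∧ ∀ i, -K ≤ hH.eigenvalues i := by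
    refine ⟨∑ i, |hH.eigenvalues i| + 1, by positivity, fun i => ?_⟩
    have h1 := Finset.single_le_sum (f := fun i => |hH.eigenvalues i|)
      (fun i _ => abs_nonneg _) (Finset.mem_univ i)
    have h2 := neg_abs_le (hH.eigenvalues i)
    linarith
  have h1 : (ρ - ε • 1).PosSemidef := by
    have := hcfc hρ.1 (fun x => x - ε) (fun i => sub_nonneg.2 (hερ i))
    rwa [cfc_sub (fun x => x) (fun _ => ε) ρ, cfc_id' ℝ ρ hρ.1.isSelfAdjoint,
      cfc_const ε ρ hρ.1.isSelfAdjoint, Algebra.algebraMap_eq_smul_one] at this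
  have h2 : (H + K • 1).PosSemidef := by
    have := hcfc hH (fun x => x + K) (fun i => by linarith [hKH i])
    rwa [cfc_add (a := H) (fun x => x) (fun _ => K), cfc_id' ℝ H hH.isSelfAdjoint,
      cfc_const K H hH.isSelfAdjoint, Algebra.algebraMap_eq_smul_one] at this
  filter_upwards [Ioo_mem_nhdsGT (div_pos hε hK)] with t ht
  have h3 : 0 < ε - t * K := by
    have := (lt_div_iff₀ hK).1 ht.2
    linarith
  have e : ρ + t • H = (ρ - ε • 1) + t • (H + K • 1) + (ε - t * K) • 1 := by
    rw [smul_add, smul_smul, sub_smul]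
    abel
  rw [e]
  exact Matrix.PosDef.posSemidef_add (h1.add (h2.smul ht.1.le)) (Matrix.PosDef.one.smul h3)

section Saturation

variable {A B C : Type*} [Fintype A] [DecidableEq A] [Fintype B] [DecidableEq B]
  [Fintype C] [DecidableEq C]

/-- The defect `log ρ - log ρ_AB - log ρ_BC + log ρ_B` of the saturation identity. -/
def logDefect (ρ : Matrix (A × B × C) (A × B × C) ℂ) : Matrix (A × B × C) (A × B × C) ℂ :=
  mlog ρ - (embAB (mlog (ptC ρ)) + embBC (mlog (ptA ρ)) - embB (mlog (ptAC ρ)))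

lemma re_trace_logDefect_mul (ρ M : Matrix (A × B × C) (A × B × C) ℂ) :
    (trace (logDefect ρ * M)).re = (trace (M * mlog ρ)).re
      - (trace (ptC M * mlog (ptC ρ))).re - (trace (ptA M * mlog (ptA ρ))).re
      + (trace (ptAC M * mlog (ptAC ρ))).re := by
  simp only [logDefect, sub_mul, add_mul, Matrix.trace_sub, Matrix.trace_add, trace_embAB_mul,
    trace_embBC_mul, trace_embB_mul, Complex.sub_re, Complex.add_re]
  rw [Matrix.trace_mul_comm (mlog ρ), Matrix.trace_mul_comm (mlog (ptC ρ)),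
    Matrix.trace_mul_comm (mlog (ptA ρ)), Matrix.trace_mul_comm (mlog (ptAC ρ))]
  ring

lemma isHermitian_mlog {n : Type*} [Fintype n] [DecidableEq n] {P : Matrix n n ℂ}
    (hP : P.IsHermitian) : (mlog P).IsHermitian := by
  rw [mlog_eq_cfc hP]
  exact (cfc_predicate Real.log P : IsSelfAdjoint _)

lemma isHermitian_logDefect {ρ : Matrix (A × B × C) (A × B × C) ℂ} (hρ : ρ.IsHermitian)
    (hAB : (ptC ρ).IsHermitian) (hBC : (ptA ρ).IsHermitian) (hB : (ptAC ρ).IsHermitian) :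
    (logDefect ρ).IsHermitian := by
  have h1 : (embAB (mlog (ptC ρ)) : Matrix (A × B × C) (A × B × C) ℂ).IsHermitian :=
    (isHermitian_mlog hAB).isSelfAdjoint.map (embABHom A B C)
  have h2 : (embBC (mlog (ptA ρ)) : Matrix (A × B × C) (A × B × C) ℂ).IsHermitian := by
    rw [embBC_eq_oneKroneckerHom]
    exact (isHermitian_mlog hBC).isSelfAdjoint.map (oneKroneckerHom A (B × C))
  exact (isHermitian_mlog hρ).sub ((h1.add h2).sub (isHermitian_embB (isHermitian_mlog hB)))

/-- A zero of the conditional mutual information is a minimum by strong subadditivity, so its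
gradient there, which is the defect of the saturation identity, vanishes. -/
lemma logDefect_eq_zero {ρ : Matrix (A × B × C) (A × B × C) ℂ} (hρ : ρ.PosDef)
    (hAB : (ptC ρ).PosDef) (hBC : (ptA ρ).PosDef) (hB : (ptAC ρ).PosDef)
    (h0 : (trace (logDefect ρ * ρ)).re = 0) : logDefect ρ = 0 := by
  set H := -logDefect ρ with hHdef
  have hL : (logDefect ρ).IsHermitian := isHermitian_logDefect hρ.1 hAB.1 hBC.1 hB.1
  have hH : H.IsHermitian := hL.neg
  set k := (trace (cfc (fun x : ℝ => x⁻¹) ρ * (H * H))).re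
    + (trace (cfc (fun x : ℝ => x⁻¹) (ptAC ρ) * (ptAC H * ptAC H))).re
  have hev : ∀ᶠ t : ℝ in nhdsWithin 0 (Set.Ioi 0),
      (trace (logDefect ρ * logDefect ρ)).re ≤ t * k := by
    filter_upwards [self_mem_nhdsWithin, hρ.eventually_posDef_add_smul hH,
      hAB.eventually_posDef_add_smul (isHermitian_ptC hH),
      hBC.eventually_posDef_add_smul (isHermitian_ptA hH),
      hB.eventually_posDef_add_smul (isHermitian_ptAC hH)] with t (ht : 0 < t) h1 h2 h3 h4
    have g1 := relEnt_add_smul_le hρ H t h1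
    have g2 := trace_sub_trace_le_relEnt h2 hAB
    have g3 := trace_sub_trace_le_relEnt h3 hBC
    have g4 := relEnt_add_smul_le hB (ptAC H) t h4
    rw [relEnt_eq_neg_vN_sub h1.1] at g1
    rw [relEnt_eq_neg_vN_sub h2.1] at g2
    rw [relEnt_eq_neg_vN_sub h3.1] at g3
    rw [relEnt_eq_neg_vN_sub h4.1] at g4
    rw [Matrix.trace_add, Matrix.trace_smul, Complex.add_re, Complex.real_smul,
      Complex.re_ofReal_mul] at g2 g3
    rw [trace_ptC H] at g2
    rw [trace_ptA H] at g3
    rw [trace_ptAC H] at g4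
    rw [← ptC_add_smul] at h2 g2
    rw [← ptA_add_smul] at h3 g3
    rw [← ptAC_add_smul] at h4 g4
    have hssa := vN_strong_subadditivity h1 h2 h3 h4
    have hlin : (trace (logDefect ρ * (ρ + t • H))).re
        = -(t * (trace (logDefect ρ * logDefect ρ)).re) := by
      simp [hHdef, mul_add, Matrix.trace_add, h0]
    rw [re_trace_logDefect_mul] at hlin
    refine le_of_mul_le_mul_left ?_ ht
    simp only [k]
    nlinarith
  have hlim : Filter.Tendsto (fun t : ℝ => t * k) (nhdsWithin 0 (Set.Ioi 0)) (nhds (0 * k)) :=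
    ((continuous_id.mul continuous_const).tendsto 0).mono_left nhdsWithin_le_nhds
  have hle : (trace (logDefect ρ * logDefect ρ)).re ≤ 0 := by
    simpa using ge_of_tendsto hlim hev
  have hpos := (Matrix.posSemidef_conjTranspose_mul_self (logDefect ρ)).trace_nonneg
  rw [← Matrix.trace_conjTranspose_mul_self_eq_zero_iff]
  refine le_antisymm ?_ hpos
  rw [hL.eq] at hpos ⊢
  exact Complex.le_def.2 ⟨hle, (Complex.le_def.1 hpos).2.symm⟩

end Saturation

/-- **Ruskai's characterization of the saturation of strong subadditivity.**
For a positive definite density matrix `ρ` on `ℂ^a ⊗ ℂ^b ⊗ ℂ^c` with positive definite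
marginals, `I(A:C|B)_ρ = 0` iff
`log ρ = log ρ_AB ⊗ I_C + I_A ⊗ log ρ_BC − I_A ⊗ log ρ_B ⊗ I_C`. -/
theorem ruskai_ssa_saturation
    (a b c : ℕ)
    (ρ : Matrix (Fin a × Fin b × Fin c) (Fin a × Fin b × Fin c) ℂ)
    (hρ : ρ.PosDef) (hρtr : ρ.trace = 1)
    (hAB : (ptC ρ).PosDef) (hBC : (ptA ρ).PosDef) (hB : (ptAC ρ).PosDef) :
    vN (ptC ρ) + vN (ptA ρ) - vN (ptAC ρ) - vN ρ = 0 ↔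
      mlog ρ = embAB (mlog (ptC ρ)) + embBC (mlog (ptA ρ)) - embB (mlog (ptAC ρ)) := by
  have hI := re_trace_logDefect_mul ρ ρ
  rw [re_trace_mul_mlog hρ.1, re_trace_mul_mlog hAB.1, re_trace_mul_mlog hBC.1,
    re_trace_mul_mlog hB.1] at hI
  constructor
  · intro h
    exact sub_eq_zero.1 (logDefect_eq_zero hρ hAB hBC hB (by linarith))
  · intro h
    rw [show logDefect ρ = 0 from sub_eq_zero.2 h, zero_mul, Matrix.trace_zero,
      Complex.zero_re] at hI
    linarith
end
end

section
/- Quantum Markov chain structure implies vanishing conditional mutual information. Let H_A = ℂ^a, H_C = ℂ^c, and suppose H_B = ℂ^b is unitarily identified with a direct sum ⊕_{i=1}^m (ℂ^{l_i} ⊗ ℂ^{r_i}) via a unitary U. Let (p_i)_{i=1}^m be a probability distribution, and for each i let ρ^i_L be a density matrix on H_A ⊗ ℂ^{l_i} and ρ^i_R a density matrix on ℂ^{r_i} ⊗ H_C. Define ρ on H_A ⊗ H_B ⊗ H_C as the image under (I_A ⊗ U† ⊗ I_C)(·)(I_A ⊗ U ⊗ I_C) of the block-diagonal operator Σ_i p_i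 · ρ^i_L ⊗ ρ^i_R (where in the i-th block the factors are reordered as A ⊗ l_i ⊗ r_i ⊗ C). Then ρ is a density matrix and its conditional mutual information vanishes: I(A:C|B)_ρ = S(ρ_AB) + S(ρ_BC) − S(ρ_B) − S(ρ) = 0. -/
noncomputable section
open Matrix
open scoped Classical ComplexOrder

open scoped Kronecker

/-- The entropy can be read off from any real factorization of the characteristic polynomial. -/
theorem vN_eq_sum_of_charpoly {n k : Type*} [Fintype n] [DecidableEq n] [Fintype k]
    {ρ : Matrix n n ℂ} (h : ρ.IsHermitian) (d : k → ℝ)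
    (hd : ρ.charpoly = ∏ j, (Polynomial.X - Polynomial.C (d j : ℂ))) :
    vN ρ = ∑ j, Real.negMulLog (d j) := by
  have h₁ := h.roots_charpoly_eq_eigenvalues
  rw [hd, Polynomial.roots_prod _ _
    (by simp [Finset.prod_ne_zero_iff, Polynomial.X_sub_C_ne_zero])] at h₁
  simp only [Polynomial.roots_X_sub_C, Multiset.bind_singleton] at h₁
  have h₂ := congrArg (fun s => (s.map fun z : ℂ => Real.negMulLog z.re).sum) h₁
  simp only [Multiset.map_map, Function.comp_def, Complex.ofReal_re, RCLike.ofReal_eq_complex_ofReal] at h₂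
  rw [vN, dif_pos h, ← Finset.sum_neg_distrib]
  simpa [Real.negMulLog] using h₂.symm

theorem vN_congr_charpoly {n k : Type*} [Fintype n] [DecidableEq n] [Fintype k] [DecidableEq k]
    {ρ : Matrix n n ℂ} {σ : Matrix k k ℂ} (hρ : ρ.IsHermitian) (hσ : σ.IsHermitian)
    (h : ρ.charpoly = σ.charpoly) : vN ρ = vN σ := by
  rw [vN_eq_sum_of_charpoly hρ hσ.eigenvalues (by rw [h]; exact hσ.charpoly_eq), vN, dif_pos hσ,
    ← Finset.sum_neg_distrib]
  simp [Real.negMulLog]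

theorem charpoly_unitary_conj {n k : Type*} [Fintype n] [DecidableEq n] [Fintype k]
    [DecidableEq k] {W : Matrix n k ℂ} (h₁ : W * Wᴴ = 1) (h₂ : Wᴴ * W = 1) (σ : Matrix k k ℂ) :
    (W * σ * Wᴴ).charpoly = σ.charpoly := by
  have hcard : Fintype.card n = Fintype.card k := by
    have h := trace_mul_comm W Wᴴ
    rw [h₁, h₂, trace_one, trace_one] at h
    exact_mod_cast h
  have h := charpoly_mul_comm' W (σ * Wᴴ)
  rw [hcard, Matrix.mul_assoc, h₂, Matrix.mul_one, ← Matrix.mul_assoc] at h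
  exact (Polynomial.isRegular_X_pow _).left.eq_iff.mp h

theorem vN_unitary_conj {n k : Type*} [Fintype n] [DecidableEq n] [Fintype k] [DecidableEq k]
    {W : Matrix n k ℂ} (h₁ : W * Wᴴ = 1) (h₂ : Wᴴ * W = 1) {σ : Matrix k k ℂ}
    (hσ : σ.IsHermitian) : vN (W * σ * Wᴴ) = vN σ :=
  vN_congr_charpoly (isHermitian_mul_mul_conjTranspose W hσ) hσ (charpoly_unitary_conj h₁ h₂ σ)

theorem vN_submatrix_equiv {n k : Type*} [Fintype n] [DecidableEq n] [Fintype k] [DecidableEq k]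
    {σ : Matrix k k ℂ} (hσ : σ.IsHermitian) (e : n ≃ k) : vN (σ.submatrix e e) = vN σ :=
  vN_congr_charpoly (hσ.submatrix e) hσ (charpoly_reindex e.symm σ)

/-- Spectral theorem as a product of matrices, together with the entropy. -/
theorem exists_unitary_diagonal {n : Type*} [Fintype n] [DecidableEq n]
    {σ : Matrix n n ℂ} (hσ : σ.IsHermitian) :
    ∃ (W : Matrix n n ℂ) (d : n → ℝ), W * Wᴴ = 1 ∧ Wᴴ * W = 1 ∧
      σ = W * diagonal (fun j => (d j : ℂ)) * Wᴴ ∧ σ.trace = ((∑ j, d j : ℝ) : ℂ) ∧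
      vN σ = ∑ j, Real.negMulLog (d j) := by
  refine ⟨hσ.eigenvectorUnitary, hσ.eigenvalues, ?_, ?_, ?_, ?_,
    vN_eq_sum_of_charpoly hσ _ hσ.charpoly_eq⟩
  · exact Unitary.coe_mul_star_self hσ.eigenvectorUnitary
  · exact Unitary.coe_star_mul_self hσ.eigenvectorUnitary
  · exact hσ.spectral_theorem
  · rw [hσ.trace_eq_sum_eigenvalues]
    push_cast
    rfl

theorem isHermitian_smul_kronecker {x y : Type*} {X : Matrix x x ℂ} {Y : Matrix y y ℂ}
    (hX : X.IsHermitian) (hY : Y.IsHermitian) (p : ℝ) :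
    ((p : ℂ) • (X ⊗ₖ Y)).IsHermitian := by
  rw [IsHermitian, conjTranspose_smul, conjTranspose_kronecker, hX.eq, hY.eq]
  simp

theorem isHermitian_blockDiagonal'_smul_kronecker {ι : Type*} [DecidableEq ι] {x y : ι → Type*}
    {p : ι → ℝ} {X : ∀ i, Matrix (x i) (x i) ℂ} {Y : ∀ i, Matrix (y i) (y i) ℂ}
    (hX : ∀ i, (X i).IsHermitian) (hY : ∀ i, (Y i).IsHermitian) :
    (blockDiagonal' fun i => (p i : ℂ) • (X i ⊗ₖ Y i)).IsHermitian :=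
  isHermitian_blockDiagonal'_iff.2 fun i => isHermitian_smul_kronecker (hX i) (hY i) (p i)

/-- Entropy of a direct sum of weighted product states. -/
theorem vN_blockDiagonal'_smul_kronecker {ι : Type*} [Fintype ι] [DecidableEq ι]
    {x y : ι → Type*} [∀ i, Fintype (x i)] [∀ i, DecidableEq (x i)]
    [∀ i, Fintype (y i)] [∀ i, DecidableEq (y i)]
    {p : ι → ℝ} {X : ∀ i, Matrix (x i) (x i) ℂ} {Y : ∀ i, Matrix (y i) (y i) ℂ}
    (hX : ∀ i, (X i).IsHermitian) (hY : ∀ i, (Y i).IsHermitian)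
    (hXtr : ∀ i, (X i).trace = 1) (hYtr : ∀ i, (Y i).trace = 1) :
    vN (blockDiagonal' fun i => (p i : ℂ) • (X i ⊗ₖ Y i)) =
      ∑ i, (Real.negMulLog (p i) + p i * (vN (X i) + vN (Y i))) := by
  choose W d hW₁ hW₂ hWd hdtr hdN using fun i => exists_unitary_diagonal (hX i)
  choose Z f hZ₁ hZ₂ hZf hftr hfN using fun i => exists_unitary_diagonal (hY i)
  have hd : ∀ i, ∑ j, d i j = 1 := fun i => by
    have := (hdtr i).symm.trans (hXtr i)
    exact_mod_cast this
  have hf : ∀ i, ∑ j, f i j = 1 := fun i => by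
    have := (hftr i).symm.trans (hYtr i)
    exact_mod_cast this
  have hdecomp : (blockDiagonal' fun i => (p i : ℂ) • (X i ⊗ₖ Y i)) =
      (blockDiagonal' fun i => W i ⊗ₖ Z i) *
        diagonal (fun q : Σ i, x i × y i => ((p q.1 * (d q.1 q.2.1 * f q.1 q.2.2) : ℝ) : ℂ)) *
        (blockDiagonal' fun i => W i ⊗ₖ Z i)ᴴ := by
    rw [blockDiagonal'_conjTranspose, ← blockDiagonal'_diagonal
      (fun i (q : x i × y i) => ((p i * (d i q.1 * f i q.2) : ℝ) : ℂ)),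
      ← blockDiagonal'_mul, ← blockDiagonal'_mul]
    congr 1
    funext i
    have hdiag : diagonal (fun q : x i × y i => ((p i * (d i q.1 * f i q.2) : ℝ) : ℂ)) =
        (p i : ℂ) • (diagonal (fun j => (d i j : ℂ)) ⊗ₖ diagonal (fun j => (f i j : ℂ))) := by
      rw [diagonal_kronecker_diagonal, ← diagonal_smul]
      congr 1
      funext q
      simp
    rw [hdiag, Matrix.mul_smul, Matrix.smul_mul, conjTranspose_kronecker, ← mul_kronecker_mul,
      ← mul_kronecker_mul, ← hWd, ← hZf]
  have hK₁ : (blockDiagonal' fun i => W i ⊗ₖ Z i) * (blockDiagonal' fun i => W i ⊗ₖ Z i)ᴴ = 1 := by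
    rw [blockDiagonal'_conjTranspose, ← blockDiagonal'_mul, ← blockDiagonal'_one]
    congr 1
    funext i
    rw [conjTranspose_kronecker, ← mul_kronecker_mul, hW₁, hZ₁, one_kronecker_one]
    rfl
  have hK₂ : (blockDiagonal' fun i => W i ⊗ₖ Z i)ᴴ * (blockDiagonal' fun i => W i ⊗ₖ Z i) = 1 := by
    rw [blockDiagonal'_conjTranspose, ← blockDiagonal'_mul, ← blockDiagonal'_one]
    congr 1
    funext i
    rw [conjTranspose_kronecker, ← mul_kronecker_mul, hW₂, hZ₂, one_kronecker_one]
    rfl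
  rw [vN_eq_sum_of_charpoly (isHermitian_blockDiagonal'_smul_kronecker hX hY)
    (fun q : Σ i, x i × y i => p q.1 * (d q.1 q.2.1 * f q.1 q.2.2))
    (by rw [hdecomp, charpoly_unitary_conj hK₁ hK₂, charpoly_diagonal]), Fintype.sum_sigma]
  refine Finset.sum_congr rfl fun i _ => ?_
  simp only [Fintype.sum_prod_type, Real.negMulLog_mul, Finset.sum_add_distrib, ← Finset.mul_sum,
    ← Finset.sum_mul, mul_add, hd, hf, hdN, hfN, one_mul, mul_one]

/-- Partial trace over the first factor of a bipartite system. -/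
def partialTraceFst {x y : Type*} [Fintype x] (X : Matrix (x × y) (x × y) ℂ) : Matrix y y ℂ :=
  Matrix.of fun s t => ∑ a, X (a, s) (a, t)

/-- Partial trace over the second factor of a bipartite system. -/
def partialTraceSnd {x y : Type*} [Fintype y] (X : Matrix (x × y) (x × y) ℂ) : Matrix x x ℂ :=
  Matrix.of fun s t => ∑ c, X (s, c) (t, c)

theorem isHermitian_partialTraceFst {x y : Type*} [Fintype x] {X : Matrix (x × y) (x × y) ℂ}
    (hX : X.IsHermitian) : (partialTraceFst X).IsHermitian := by
  ext s t
  simp only [partialTraceFst, conjTranspose_apply, of_apply, star_sum]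
  exact Finset.sum_congr rfl fun a _ => hX.apply _ _

theorem isHermitian_partialTraceSnd {x y : Type*} [Fintype y] {X : Matrix (x × y) (x × y) ℂ}
    (hX : X.IsHermitian) : (partialTraceSnd X).IsHermitian := by
  ext s t
  simp only [partialTraceSnd, conjTranspose_apply, of_apply, star_sum]
  exact Finset.sum_congr rfl fun a _ => hX.apply _ _

theorem trace_partialTraceFst {x y : Type*} [Fintype x] [Fintype y]
    (X : Matrix (x × y) (x × y) ℂ) : (partialTraceFst X).trace = X.trace := by
  simp only [partialTraceFst, trace, diag_apply, of_apply, Fintype.sum_prod_type]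
  exact Finset.sum_comm

theorem trace_partialTraceSnd {x y : Type*} [Fintype x] [Fintype y]
    (X : Matrix (x × y) (x × y) ℂ) : (partialTraceSnd X).trace = X.trace := by
  simp only [partialTraceSnd, trace, diag_apply, of_apply, Fintype.sum_prod_type]

theorem posSemidef_blockDiagonal' {ι : Type*} [Fintype ι] [DecidableEq ι] {x : ι → Type*}
    [∀ i, Fintype (x i)] {X : ∀ i, Matrix (x i) (x i) ℂ} (hX : ∀ i, (X i).PosSemidef) :
    (blockDiagonal' X).PosSemidef := by
  have hfac : ∀ i, ∃ Y : Matrix (x i) (x i) ℂ, X i = Yᴴ * Y := fun i => by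
    open scoped MatrixOrder in
    exact CStarAlgebra.nonneg_iff_eq_star_mul_self.mp (hX i).nonneg
  choose Y hY using hfac
  have h : blockDiagonal' X = (blockDiagonal' Y)ᴴ * blockDiagonal' Y := by
    rw [blockDiagonal'_conjTranspose, ← blockDiagonal'_mul]
    exact congrArg blockDiagonal' (funext hY)
  rw [h]
  exact posSemidef_conjTranspose_mul_self _

theorem ptAC_eq_partialTraceFst_ptC {A B C : Type*} [Fintype A] [Fintype C]
    (N : Matrix (A × B × C) (A × B × C) ℂ) : ptAC N = partialTraceFst (ptC N) := rfl

section Conjugation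

variable {A B D C : Type*} [Fintype A] [Fintype D] [Fintype C] [DecidableEq A] [DecidableEq C]

theorem one_kronecker_conj_apply {W : Matrix B D ℂ} (N : Matrix (A × D) (A × D) ℂ)
    (s t : A × B) :
    (((1 : Matrix A A ℂ) ⊗ₖ W) * N * ((1 : Matrix A A ℂ) ⊗ₖ W)ᴴ) s t =
      ∑ y, ∑ x, W s.2 x * N (s.1, x) (t.1, y) * star (W t.2 y) := by
  simp [Matrix.mul_apply, Fintype.sum_prod_type, one_apply, Finset.sum_mul,
    apply_ite (starRingEnd ℂ)]

theorem kronecker_one_conj_apply {W : Matrix B D ℂ} (N : Matrix (D × C) (D × C) ℂ)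
    (s t : B × C) :
    ((W ⊗ₖ (1 : Matrix C C ℂ)) * N * (W ⊗ₖ (1 : Matrix C C ℂ))ᴴ) s t =
      ∑ y, ∑ x, W s.1 x * N (x, s.2) (y, t.2) * star (W t.1 y) := by
  simp [Matrix.mul_apply, Fintype.sum_prod_type, one_apply, Finset.sum_mul,
    apply_ite (starRingEnd ℂ)]

theorem one_kronecker_kronecker_one_conj_apply {W : Matrix B D ℂ}
    (N : Matrix (A × D × C) (A × D × C) ℂ) (s t : A × B × C) :
    (((1 : Matrix A A ℂ) ⊗ₖ (W ⊗ₖ (1 : Matrix C C ℂ))) * N *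
        ((1 : Matrix A A ℂ) ⊗ₖ (W ⊗ₖ (1 : Matrix C C ℂ)))ᴴ) s t =
      ∑ y, ∑ x, W s.2.1 x * N (s.1, x, s.2.2) (t.1, y, t.2.2) * star (W t.2.1 y) := by
  simp [Matrix.mul_apply, Fintype.sum_prod_type, one_apply, Finset.sum_mul,
    apply_ite (starRingEnd ℂ)]

theorem ptC_conj (W : Matrix B D ℂ) (N : Matrix (A × D × C) (A × D × C) ℂ) :
    ptC (((1 : Matrix A A ℂ) ⊗ₖ (W ⊗ₖ (1 : Matrix C C ℂ))) * N *
        ((1 : Matrix A A ℂ) ⊗ₖ (W ⊗ₖ (1 : Matrix C C ℂ)))ᴴ) =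
      ((1 : Matrix A A ℂ) ⊗ₖ W) * ptC N * ((1 : Matrix A A ℂ) ⊗ₖ W)ᴴ := by
  ext s t
  simp only [ptC, of_apply, one_kronecker_kronecker_one_conj_apply]
  simp only [one_kronecker_conj_apply, of_apply, Finset.mul_sum, Finset.sum_mul]
  rw [Finset.sum_comm]
  exact Finset.sum_congr rfl fun _ _ => Finset.sum_comm

theorem ptA_conj (W : Matrix B D ℂ) (N : Matrix (A × D × C) (A × D × C) ℂ) :
    ptA (((1 : Matrix A A ℂ) ⊗ₖ (W ⊗ₖ (1 : Matrix C C ℂ))) * N *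
        ((1 : Matrix A A ℂ) ⊗ₖ (W ⊗ₖ (1 : Matrix C C ℂ)))ᴴ) =
      (W ⊗ₖ (1 : Matrix C C ℂ)) * ptA N * (W ⊗ₖ (1 : Matrix C C ℂ))ᴴ := by
  ext s t
  simp only [ptA, of_apply, one_kronecker_kronecker_one_conj_apply]
  simp only [kronecker_one_conj_apply, of_apply, Finset.mul_sum, Finset.sum_mul]
  rw [Finset.sum_comm]
  exact Finset.sum_congr rfl fun _ _ => Finset.sum_comm

theorem partialTraceFst_conj (W : Matrix B D ℂ) (N : Matrix (A × D) (A × D) ℂ) :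
    partialTraceFst (((1 : Matrix A A ℂ) ⊗ₖ W) * N * ((1 : Matrix A A ℂ) ⊗ₖ W)ᴴ) =
      W * partialTraceFst N * Wᴴ := by
  ext s t
  simp only [partialTraceFst, of_apply, one_kronecker_conj_apply]
  simp only [Matrix.mul_apply, conjTranspose_apply, of_apply, Finset.mul_sum, Finset.sum_mul]
  rw [Finset.sum_comm]
  exact Finset.sum_congr rfl fun _ _ => Finset.sum_comm

end Conjugation

section MarkovState

variable {ι A C : Type*} {L R : ι → Type*}

/-- Regrouping `A ⊗ (⊕ᵢ Lᵢ ⊗ Rᵢ)` as `⊕ᵢ (A ⊗ Lᵢ) ⊗ Rᵢ`. -/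
def prodSigmaRegroup (A : Type*) (L R : ι → Type*) :
    A × (Σ i, L i × R i) ≃ Σ i, (A × L i) × R i where
  toFun q := ⟨q.2.1, (q.1, q.2.2.1), q.2.2.2⟩
  invFun q := (q.2.1.1, ⟨q.1, q.2.1.2, q.2.2⟩)
  left_inv _ := rfl
  right_inv _ := rfl

/-- Regrouping `(⊕ᵢ Lᵢ ⊗ Rᵢ) ⊗ C` as `⊕ᵢ Lᵢ ⊗ (Rᵢ ⊗ C)`. -/
def sigmaProdRegroup (C : Type*) (L R : ι → Type*) :
    (Σ i, L i × R i) × C ≃ Σ i, L i × (R i × C) where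
  toFun q := ⟨q.1.1, q.1.2.1, q.1.2.2, q.2⟩
  invFun q := (⟨q.1, q.2.1, q.2.2.1⟩, q.2.2.2)
  left_inv _ := rfl
  right_inv _ := rfl

/-- Regrouping `A ⊗ (⊕ᵢ Lᵢ ⊗ Rᵢ) ⊗ C` as `⊕ᵢ (A ⊗ Lᵢ) ⊗ (Rᵢ ⊗ C)`. -/
def prodSigmaProdRegroup (A C : Type*) (L R : ι → Type*) :
    A × (Σ i, L i × R i) × C ≃ Σ i, (A × L i) × (R i × C) where
  toFun q := ⟨q.2.1.1, (q.1, q.2.1.2.1), (q.2.1.2.2, q.2.2)⟩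
  invFun q := (q.2.1.1, ⟨q.1, q.2.1.2, q.2.2.1⟩, q.2.2.2)
  left_inv _ := rfl
  right_inv _ := rfl

variable [DecidableEq ι] (p : ι → ℝ) (X : ∀ i, Matrix (A × L i) (A × L i) ℂ)
  (Y : ∀ i, Matrix (R i × C) (R i × C) ℂ)

theorem ptC_markovState [Fintype C] :
    ptC ((blockDiagonal' fun i => (p i : ℂ) • (X i ⊗ₖ Y i)).submatrix
        (prodSigmaProdRegroup A C L R) (prodSigmaProdRegroup A C L R)) =
      (blockDiagonal' fun i => (p i : ℂ) • (X i ⊗ₖ partialTraceSnd (Y i))).submatrix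
        (prodSigmaRegroup A L R) (prodSigmaRegroup A L R) := by
  ext ⟨a, i, s, t⟩ ⟨a', j, s', t'⟩
  by_cases h : i = j
  · subst h
    simp [ptC, prodSigmaProdRegroup, prodSigmaRegroup, partialTraceSnd, blockDiagonal'_apply_eq,
      Finset.mul_sum]
  · simp [ptC, prodSigmaProdRegroup, prodSigmaRegroup, blockDiagonal'_apply_ne _ _ _ h]

theorem ptA_markovState [Fintype A] :
    ptA ((blockDiagonal' fun i => (p i : ℂ) • (X i ⊗ₖ Y i)).submatrix
        (prodSigmaProdRegroup A C L R) (prodSigmaProdRegroup A C L R)) =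
      (blockDiagonal' fun i => (p i : ℂ) • (partialTraceFst (X i) ⊗ₖ Y i)).submatrix
        (sigmaProdRegroup C L R) (sigmaProdRegroup C L R) := by
  ext ⟨⟨i, s, t⟩, c⟩ ⟨⟨j, s', t'⟩, c'⟩
  by_cases h : i = j
  · subst h
    simp [ptA, prodSigmaProdRegroup, sigmaProdRegroup, partialTraceFst, blockDiagonal'_apply_eq,
      Finset.mul_sum, Finset.sum_mul]
  · simp [ptA, prodSigmaProdRegroup, sigmaProdRegroup, blockDiagonal'_apply_ne _ _ _ h]

theorem partialTraceFst_markovState [Fintype A] (Z : ∀ i, Matrix (R i) (R i) ℂ) :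
    partialTraceFst ((blockDiagonal' fun i => (p i : ℂ) • (X i ⊗ₖ Z i)).submatrix
        (prodSigmaRegroup A L R) (prodSigmaRegroup A L R)) =
      blockDiagonal' fun i => (p i : ℂ) • (partialTraceFst (X i) ⊗ₖ Z i) := by
  ext ⟨i, s, t⟩ ⟨j, s', t'⟩
  by_cases h : i = j
  · subst h
    simp [prodSigmaRegroup, partialTraceFst, blockDiagonal'_apply_eq,
      Finset.mul_sum, Finset.sum_mul]
  · simp [prodSigmaRegroup, partialTraceFst, blockDiagonal'_apply_ne _ _ _ h]

end MarkovState

/-- **Quantum Markov chain structure implies vanishing conditional mutual information.**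
If `H_B` is unitarily identified with `⊕_i ℂ^{l_i} ⊗ ℂ^{r_i}` and
`ρ = (I_A ⊗ U† ⊗ I_C) (Σ_i p_i ρ^i_L ⊗ ρ^i_R) (I_A ⊗ U ⊗ I_C)` is block diagonal with
blocks `ρ^i_L ⊗ ρ^i_R` on `(A ⊗ l_i) ⊗ (r_i ⊗ C)`, then `ρ` is a density matrix and
`I(A:C|B)_ρ = 0`. -/
theorem markov_chain_structure_implies_cmi_zero
    (a b c m : ℕ) (l r : Fin m → ℕ)
    (U : Matrix (Fin b) (Σ i : Fin m, Fin (l i) × Fin (r i)) ℂ)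
    (hU₁ : U * Uᴴ = 1) (hU₂ : Uᴴ * U = 1)
    (p : Fin m → ℝ) (hp : ∀ i, 0 ≤ p i) (hps : ∑ i, p i = 1)
    (ρL : ∀ i : Fin m, Matrix (Fin a × Fin (l i)) (Fin a × Fin (l i)) ℂ)
    (hρL : ∀ i, (ρL i).PosSemidef) (hρLtr : ∀ i, (ρL i).trace = 1)
    (ρR : ∀ i : Fin m, Matrix (Fin (r i) × Fin c) (Fin (r i) × Fin c) ℂ)
    (hρR : ∀ i, (ρR i).PosSemidef) (hρRtr : ∀ i, (ρR i).trace = 1)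
    (M : Matrix (Fin a × (Σ i : Fin m, Fin (l i) × Fin (r i)) × Fin c)
                (Fin a × (Σ i : Fin m, Fin (l i) × Fin (r i)) × Fin c) ℂ)
    (hM : M = Matrix.of fun pq qr =>
      if h : qr.2.1.1 = pq.2.1.1 then
        ((p pq.2.1.1 : ℝ) : ℂ) *
          ρL pq.2.1.1 (pq.1, pq.2.1.2.1) (qr.1, h ▸ qr.2.1.2.1) *
          ρR pq.2.1.1 (pq.2.1.2.2, pq.2.2) (h ▸ qr.2.1.2.2, qr.2.2)
      else 0)
    (V : Matrix (Fin a × Fin b × Fin c)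
                (Fin a × (Σ i : Fin m, Fin (l i) × Fin (r i)) × Fin c) ℂ)
    (hV : V = Matrix.of fun pq qr =>
      (if pq.1 = qr.1 then 1 else 0) * U pq.2.1 qr.2.1 * (if pq.2.2 = qr.2.2 then 1 else 0))
    (ρ : Matrix (Fin a × Fin b × Fin c) (Fin a × Fin b × Fin c) ℂ)
    (hρ : ρ = V * M * Vᴴ) :
    ρ.PosSemidef ∧ ρ.trace = 1 ∧
      vN (ptC ρ) + vN (ptA ρ) - vN (ptAC ρ) - vN ρ = 0 := by
  have hV' : V = (1 : Matrix (Fin a) (Fin a) ℂ) ⊗ₖ (U ⊗ₖ (1 : Matrix (Fin c) (Fin c) ℂ)) := by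
    rw [hV]
    ext s t
    simp [one_apply]
  have hM' : M = (blockDiagonal' fun i => (p i : ℂ) • (ρL i ⊗ₖ ρR i)).submatrix
      (prodSigmaProdRegroup (Fin a) (Fin c) (fun i => Fin (l i)) fun i => Fin (r i))
      (prodSigmaProdRegroup (Fin a) (Fin c) (fun i => Fin (l i)) fun i => Fin (r i)) := by
    rw [hM]
    ext ⟨x, ⟨i, s, t⟩, z⟩ ⟨x', ⟨j, s', t'⟩, z'⟩
    by_cases h : j = i
    · subst h
      simp [prodSigmaProdRegroup, blockDiagonal'_apply_eq, mul_assoc]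
    · simp [prodSigmaProdRegroup, blockDiagonal'_apply_ne _ _ _ (Ne.symm h), h]
  have hL := fun i => (hρL i).isHermitian
  have hR := fun i => (hρR i).isHermitian
  have hL' := fun i => isHermitian_partialTraceFst (hL i)
  have hR' := fun i => isHermitian_partialTraceSnd (hR i)
  have hLtr := fun i => (trace_partialTraceFst (ρL i)).trans (hρLtr i)
  have hRtr := fun i => (trace_partialTraceSnd (ρR i)).trans (hρRtr i)
  have hAU₁ : ((1 : Matrix (Fin a) (Fin a) ℂ) ⊗ₖ U) * ((1 : Matrix (Fin a) (Fin a) ℂ) ⊗ₖ U)ᴴ = 1 := by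
    rw [conjTranspose_kronecker, ← mul_kronecker_mul, hU₁]
    simp
  have hAU₂ : ((1 : Matrix (Fin a) (Fin a) ℂ) ⊗ₖ U)ᴴ * ((1 : Matrix (Fin a) (Fin a) ℂ) ⊗ₖ U) = 1 := by
    rw [conjTranspose_kronecker, ← mul_kronecker_mul, hU₂]
    simp
  have hUC₁ : (U ⊗ₖ (1 : Matrix (Fin c) (Fin c) ℂ)) * (U ⊗ₖ (1 : Matrix (Fin c) (Fin c) ℂ))ᴴ = 1 := by
    rw [conjTranspose_kronecker, ← mul_kronecker_mul, hU₁]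
    simp
  have hUC₂ : (U ⊗ₖ (1 : Matrix (Fin c) (Fin c) ℂ))ᴴ * (U ⊗ₖ (1 : Matrix (Fin c) (Fin c) ℂ)) = 1 := by
    rw [conjTranspose_kronecker, ← mul_kronecker_mul, hU₂]
    simp
  have hV₁ : V * Vᴴ = 1 := by
    rw [hV', conjTranspose_kronecker, ← mul_kronecker_mul, hUC₁]
    simp
  have hV₂ : Vᴴ * V = 1 := by
    rw [hV', conjTranspose_kronecker, ← mul_kronecker_mul, hUC₂]
    simp
  have hMpos : M.PosSemidef := by
    rw [hM']
    exact (posSemidef_blockDiagonal' fun i =>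
      ((hρL i).kronecker (hρR i)).smul (Complex.zero_le_real.2 (hp i))).submatrix _
  have hMtr : M.trace = 1 := by
    have htr := Equiv.sum_comp
      (prodSigmaProdRegroup (Fin a) (Fin c) (fun i => Fin (l i)) fun i => Fin (r i))
      (blockDiagonal' fun i => (p i : ℂ) • (ρL i ⊗ₖ ρR i)).diag
    rw [hM']
    refine htr.trans ?_
    change trace (blockDiagonal' _) = 1
    simp only [trace_blockDiagonal', trace_smul, trace_kronecker, hρLtr, hρRtr]
    simpa using congrArg (fun t : ℝ => (t : ℂ)) hps
  refine ⟨hρ ▸ hMpos.mul_mul_conjTranspose_same V, ?_, ?_⟩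
  · rw [hρ, trace_mul_comm, ← Matrix.mul_assoc, hV₂, Matrix.one_mul, hMtr]
  · have hABC : vN ρ = ∑ i, (Real.negMulLog (p i) + p i * (vN (ρL i) + vN (ρR i))) := by
      rw [hρ, vN_unitary_conj hV₁ hV₂ hMpos.isHermitian, hM',
        vN_submatrix_equiv (isHermitian_blockDiagonal'_smul_kronecker hL hR),
        vN_blockDiagonal'_smul_kronecker hL hR hρLtr hρRtr]
    have hAB : vN (ptC ρ) = ∑ i, (Real.negMulLog (p i) +
        p i * (vN (ρL i) + vN (partialTraceSnd (ρR i)))) := by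
      have h := isHermitian_blockDiagonal'_smul_kronecker (p := p) hL hR'
      rw [hρ, hV', ptC_conj, hM', ptC_markovState, vN_unitary_conj hAU₁ hAU₂ (h.submatrix _),
        vN_submatrix_equiv h, vN_blockDiagonal'_smul_kronecker hL hR' hρLtr hRtr]
    have hBC : vN (ptA ρ) = ∑ i, (Real.negMulLog (p i) +
        p i * (vN (partialTraceFst (ρL i)) + vN (ρR i))) := by
      have h := isHermitian_blockDiagonal'_smul_kronecker (p := p) hL' hR
      rw [hρ, hV', ptA_conj, hM', ptA_markovState, vN_unitary_conj hUC₁ hUC₂ (h.submatrix _),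
        vN_submatrix_equiv h, vN_blockDiagonal'_smul_kronecker hL' hR hLtr hρRtr]
    have hB : vN (ptAC ρ) = ∑ i, (Real.negMulLog (p i) +
        p i * (vN (partialTraceFst (ρL i)) + vN (partialTraceSnd (ρR i)))) := by
      have h := isHermitian_blockDiagonal'_smul_kronecker (p := p) hL' hR'
      rw [hρ, hV', ptAC_eq_partialTraceFst_ptC, ptC_conj, hM', ptC_markovState,
        partialTraceFst_conj, partialTraceFst_markovState, vN_unitary_conj hU₁ hU₂ h,
        vN_blockDiagonal'_smul_kronecker hL' hR' hLtr hRtr]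
    rw [hABC, hAB, hBC, hB, ← Finset.sum_add_distrib, ← Finset.sum_sub_distrib,
      ← Finset.sum_sub_distrib]
    exact Finset.sum_eq_zero fun i _ => by ring
end
end

section
/- Average entanglement entropy cannot increase under separable (product-Kraus) operations on pure states. Let ψ be a unit vector in ℂ^{dA} ⊗ ℂ^{dB} with ρ = |ψ⟩⟨ψ|, and let {F_k ⊗ G_k}_{k∈K} (K a finite index set, F_k ∈ Matrix (Fin dA) (Fin dA) ℂ, G_k ∈ Matrix (Fin dB) (Fin dB) ℂ) satisfy the completeness relation Σ_k (F_k ⊗ G_k)ᴴ (F_k ⊗ G_k) = 1. Set p_k = tr[(F_k ⊗ G_k) ρ (F_k ⊗ G_k)ᴴ] and, whenever p_k > 0, σ^{(k)} = (F_k ⊗ G_k) ρ (F_k ⊗ G_k)ᴴ / p_k. Then Σ_{k : p_k > 0} p_k · S(tr_A σ^{(k)}) ≤ S(tr_A ρ). -/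
noncomputable section
open Matrix Kronecker
open scoped Classical ComplexOrder

/-- partial trace over the first factor `A`: `(tr_A M)_{j,j'} = Σ_i M_{(i,j),(i,j')}`. -/
def ptraceA {A B : Type*} [Fintype A] (M : Matrix (A × B) (A × B) ℂ) : Matrix B B ℂ :=
  Matrix.of fun j j' => ∑ i, M (i, j) (i, j')

/-- Position of `i` in the decreasing enumeration of eigenvalues used by
`Matrix.IsHermitian.eigenvalues`. -/
def eigenRank {n : Type*} [Fintype n] [DecidableEq n] (i : n) : Fin (Fintype.card n) :=
  (Fintype.equivOfCardEq (Fintype.card_fin _) : Fin (Fintype.card n) ≃ n).symm i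

lemma eigenvalues_le_of_eigenRank_le {n : Type*} [Fintype n] [DecidableEq n]
    {M : Matrix n n ℂ} (hM : M.IsHermitian) {i j : n} (h : eigenRank i ≤ eigenRank j) :
    hM.eigenvalues j ≤ hM.eigenvalues i :=
  hM.eigenvalues₀_antitone h

/-- Squared Frobenius norm. -/
def frobSq {m n : Type*} [Fintype m] [Fintype n] (D : Matrix m n ℂ) : ℝ := (D * Dᴴ).trace.re

lemma frobSq_nonneg {m n : Type*} [Fintype m] [Fintype n] (D : Matrix m n ℂ) :
    0 ≤ frobSq D :=
  (Complex.nonneg_iff.mp (Matrix.posSemidef_self_mul_conjTranspose D).trace_nonneg).1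

lemma frobSq_smul {m n : Type*} [Fintype m] [Fintype n] (c : ℝ) (D : Matrix m n ℂ) :
    frobSq (c • D) = c ^ 2 * frobSq D := by
  simp [frobSq, conjTranspose_smul, smul_smul, pow_two, mul_assoc]

lemma frobSq_projection_mul {m n : Type*} [Fintype m] [Fintype n] {Q : Matrix m m ℂ}
    (hQ : Qᴴ = Q) (hQQ : Q * Q = Q) (D : Matrix m n ℂ) :
    frobSq (Q * D) = (Q * (D * Dᴴ)).trace.re := by
  rw [frobSq, conjTranspose_mul, hQ, ← Matrix.mul_assoc, trace_mul_comm, ← Matrix.mul_assoc,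
    ← Matrix.mul_assoc, hQQ, Matrix.mul_assoc]

lemma frobSq_projection_mul_le {m n : Type*} [Fintype m] [Fintype n] [DecidableEq m]
    {Q : Matrix m m ℂ} (hQ : Qᴴ = Q) (hQQ : Q * Q = Q) (D : Matrix m n ℂ) :
    frobSq (Q * D) ≤ frobSq D := by
  have h := frobSq_nonneg ((1 - Q) * D)
  rw [frobSq_projection_mul (by simp [hQ]) (by simp [sub_mul, mul_sub, hQQ]), Matrix.sub_mul,
    trace_sub, Complex.sub_re, Matrix.one_mul, ← frobSq_projection_mul hQ hQQ] at h
  exact sub_nonneg.mp h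

lemma exists_unitary_diagonalization {n : Type*} [Fintype n] [DecidableEq n]
    {M : Matrix n n ℂ} (hM : M.IsHermitian) :
    ∃ U : Matrix n n ℂ, Uᴴ * U = 1 ∧ U * Uᴴ = 1 ∧
      M = U * diagonal (fun i => (hM.eigenvalues i : ℂ)) * Uᴴ := by
  refine ⟨hM.eigenvectorUnitary, ?_, ?_, ?_⟩
  · exact Unitary.coe_star_mul_self hM.eigenvectorUnitary
  · exact Unitary.coe_mul_star_self hM.eigenvectorUnitary
  · have := hM.spectral_theorem
    rw [Unitary.conjStarAlgAut_apply] at this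
    exact this

lemma unitary_conj_diagonal_mul {n : Type*} [Fintype n] [DecidableEq n] {U : Matrix n n ℂ}
    (hU : Uᴴ * U = 1) (a b : n → ℂ) :
    U * diagonal a * Uᴴ * (U * diagonal b * Uᴴ) = U * diagonal (fun i => a i * b i) * Uᴴ := by
  rw [← diagonal_mul_diagonal]
  calc _ = U * diagonal a * (Uᴴ * U) * diagonal b * Uᴴ := by simp only [Matrix.mul_assoc]
    _ = _ := by rw [hU]; simp only [Matrix.mul_one, Matrix.mul_assoc]

lemma unitary_conj_diagonal_conjTranspose {n : Type*} [Fintype n] [DecidableEq n]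
    (U : Matrix n n ℂ) (a : n → ℝ) :
    (U * diagonal (fun i => (a i : ℂ)) * Uᴴ)ᴴ = U * diagonal (fun i => (a i : ℂ)) * Uᴴ := by
  simp only [conjTranspose_mul, conjTranspose_conjTranspose, diagonal_conjTranspose,
    Matrix.mul_assoc]
  congr 3
  ext i
  simp

lemma trace_unitary_conj_diagonal {n : Type*} [Fintype n] [DecidableEq n] {U : Matrix n n ℂ}
    (hU : Uᴴ * U = 1) (a : n → ℂ) : (U * diagonal a * Uᴴ).trace = ∑ i, a i := by
  rw [trace_mul_comm, ← Matrix.mul_assoc, hU, Matrix.one_mul, trace_diagonal]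

/-- The orthogonal projection onto the left kernel of a matrix. -/
lemma exists_left_kernel_projection {m n : Type*} [Fintype m] [Fintype n] [DecidableEq m]
    (Y : Matrix m n ℂ) :
    ∃ Q : Matrix m m ℂ, Qᴴ = Q ∧ Q * Q = Q ∧ Q * Y = 0 ∧
      Q.trace.re + Y.rank = Fintype.card m := by
  have hM : (Y * Yᴴ).IsHermitian := isHermitian_mul_conjTranspose_self Y
  obtain ⟨U, hU, -, hD⟩ := exists_unitary_diagonalization hM
  let a : m → ℝ := fun i => if hM.eigenvalues i = 0 then 1 else 0
  refine ⟨U * diagonal (fun i => (a i : ℂ)) * Uᴴ, unitary_conj_diagonal_conjTranspose U a,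
    ?_, ?_, ?_⟩
  · rw [unitary_conj_diagonal_mul hU]
    congr 3
    ext i
    by_cases h : hM.eigenvalues i = 0 <;> simp [a, h]
  · rw [← mul_self_mul_conjTranspose_eq_zero, hD, unitary_conj_diagonal_mul hU]
    have : (fun i => (a i : ℂ) * (hM.eigenvalues i : ℂ)) = fun _ => 0 := by
      ext i
      by_cases h : hM.eigenvalues i = 0 <;> simp [a, h]
    simp [this]
  · rw [trace_unitary_conj_diagonal hU, ← rank_self_mul_conjTranspose Y,
      hM.rank_eq_card_non_zero_eigs, ← Complex.ofReal_sum, Complex.ofReal_re,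
      Fintype.card_subtype, Finset.sum_boole]
    exact_mod_cast Finset.card_filter_add_card_filter_not (s := Finset.univ)
      (fun i => hM.eigenvalues i = 0)

lemma diag_projection_mem_unitInterval {n : Type*} [Fintype n] {R : Matrix n n ℂ} (hR : Rᴴ = R)
    (hRR : R * R = R) (i : n) : 0 ≤ (R i i).re ∧ (R i i).re ≤ 1 := by
  have h : (R i i).re = ∑ j, Complex.normSq (R i j) := by
    conv_lhs => rw [← hRR, mul_apply, Complex.re_sum]
    refine Finset.sum_congr rfl fun j _ => ?_
    have : R j i = star (R i j) := by rw [← conjTranspose_apply, hR]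
    rw [this, Complex.star_def, Complex.mul_conj, Complex.ofReal_re]
  have h0 : 0 ≤ (R i i).re := h ▸ Finset.sum_nonneg fun j _ => Complex.normSq_nonneg _
  have h1 : Complex.normSq (R i i) ≤ (R i i).re := by
    rw [h]
    exact Finset.single_le_sum (f := fun j => Complex.normSq (R i j))
      (fun j _ => Complex.normSq_nonneg _) (Finset.mem_univ i)
  rw [Complex.normSq_apply] at h1
  exact ⟨h0, by nlinarith [mul_self_nonneg (R i i).im]⟩

/-- A weighting in `[0, 1]` of total mass at least the size of the tail dominates the tail sum
of a nonnegative decreasing sequence. -/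
lemma tail_sum_le_weighted_sum {n ι : Type*} [Fintype n] [LinearOrder ι] (r : n → ι)
    (P : ι → Prop) [DecidablePred P] (hP : ∀ x y, x ≤ y → P x → P y) (s a : n → ℝ)
    (hs : ∀ i, 0 ≤ s i) (hanti : ∀ i j, r i ≤ r j → s j ≤ s i)
    (ha : ∀ i, 0 ≤ a i ∧ a i ≤ 1)
    (hcard : ((Finset.univ.filter fun i => P (r i)).card : ℝ) ≤ ∑ i, a i) :
    ∑ i, (if P (r i) then s i else 0) ≤ ∑ i, s i * a i := by
  obtain ⟨t, ht0, ht1, ht2⟩ : ∃ t : ℝ, 0 ≤ t ∧ (∀ i, P (r i) → s i ≤ t) ∧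
      ∀ i, ¬ P (r i) → t ≤ s i := by
    rcases (Finset.univ.filter fun i => P (r i)).eq_empty_or_nonempty with h | h
    · refine ⟨0, le_rfl, fun i hi => ?_, fun i _ => hs i⟩
      have : i ∈ Finset.univ.filter fun i => P (r i) := by simpa using hi
      simp [h] at this
    · obtain ⟨k, hk, hmin⟩ := Finset.exists_min_image _ r h
      refine ⟨s k, hs k, fun i hi => hanti _ _ (hmin i (by simpa using hi)), fun i hi => ?_⟩
      refine hanti _ _ (le_of_not_ge fun hle => hi (hP _ _ hle (by simpa using hk)))
  have hterm : ∀ i, t * (a i - if P (r i) then 1 else 0) ≤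
      s i * a i - if P (r i) then s i else 0 := by
    intro i
    obtain ⟨h0, h1⟩ := ha i
    split_ifs with h
    · nlinarith [ht1 i h]
    · nlinarith [ht2 i h]
  have hsum := Finset.sum_le_sum fun i (_ : i ∈ Finset.univ) => hterm i
  rw [← Finset.mul_sum, Finset.sum_sub_distrib, Finset.sum_sub_distrib, Finset.sum_boole] at hsum
  nlinarith [mul_nonneg ht0 (sub_nonneg.mpr hcard)]

/-- Sum of the eigenvalues of a Hermitian matrix from position `m` on, in decreasing order. -/
def tailSum {n : Type*} [Fintype n] [DecidableEq n] {M : Matrix n n ℂ} (hM : M.IsHermitian)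
    (m : ℕ) : ℝ :=
  ∑ i, if m ≤ (eigenRank i : ℕ) then hM.eigenvalues i else 0

/-- Lower bound of the Eckart–Young theorem. -/
lemma tailSum_le_frobSq_sub {m n : Type*} [Fintype m] [Fintype n] [DecidableEq m]
    (Z Y : Matrix m n ℂ) (hM : (Z * Zᴴ).IsHermitian) (N : ℕ)
    (hY : Y.rank ≤ (Finset.univ.filter fun i : m => ¬ N ≤ (eigenRank i : ℕ)).card) :
    tailSum hM N ≤ frobSq (Z - Y) := by
  obtain ⟨Q, hQ, hQQ, hQY, htr⟩ := exists_left_kernel_projection Y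
  obtain ⟨U, hU, hU', hD⟩ := exists_unitary_diagonalization hM
  have hR : (Uᴴ * Q * U)ᴴ = Uᴴ * Q * U := by
    simp [conjTranspose_mul, hQ, Matrix.mul_assoc]
  have hRR : Uᴴ * Q * U * (Uᴴ * Q * U) = Uᴴ * Q * U := by
    calc _ = Uᴴ * Q * (U * Uᴴ) * Q * U := by simp only [Matrix.mul_assoc]
      _ = Uᴴ * (Q * Q) * U := by rw [hU']; simp only [Matrix.mul_one, Matrix.mul_assoc]
      _ = _ := by rw [hQQ]
  calc tailSum hM N
      ≤ ∑ i, hM.eigenvalues i * ((Uᴴ * Q * U) i i).re := by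
        refine tail_sum_le_weighted_sum (fun i : m => (eigenRank i : ℕ)) (fun x => N ≤ x)
          (fun x y hxy hx => hx.trans hxy) _ _
          (posSemidef_self_mul_conjTranspose Z).eigenvalues_nonneg
          (fun i j hij => eigenvalues_le_of_eigenRank_le hM hij)
          (diag_projection_mem_unitInterval hR hRR) ?_
        have h1 : ∑ i, ((Uᴴ * Q * U) i i).re = Q.trace.re := by
          rw [← Complex.re_sum]
          change (trace (Uᴴ * Q * U)).re = _
          rw [Matrix.mul_assoc, trace_mul_comm, Matrix.mul_assoc, hU', Matrix.mul_one]
        have h2 := Finset.card_filter_add_card_filter_not (s := (Finset.univ : Finset m))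
          (fun i => N ≤ (eigenRank i : ℕ))
        rw [h1]
        rw [Finset.card_univ] at h2
        have h3 : ((Finset.univ.filter fun i : m => N ≤ (eigenRank i : ℕ)).card : ℝ) + Y.rank ≤
            Fintype.card m := by exact_mod_cast (by omega)
        linarith
    _ = (Q * (Z * Zᴴ)).trace.re := by
        conv_rhs => rw [hD]
        rw [← Matrix.mul_assoc, trace_mul_comm, ← Matrix.mul_assoc, ← Matrix.mul_assoc]
        simp only [trace, diag_apply, mul_diagonal, Complex.re_sum, Complex.re_mul_ofReal]
        exact Finset.sum_congr rfl fun i _ => mul_comm _ _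
    _ = frobSq (Q * (Z - Y)) := by
        rw [Matrix.mul_sub, hQY, sub_zero, frobSq_projection_mul hQ hQQ]
    _ ≤ frobSq (Z - Y) := frobSq_projection_mul_le hQ hQQ _

/-- Attainment in the Eckart–Young theorem. -/
lemma exists_rank_le_frobSq_sub_eq_tailSum {m n : Type*} [Fintype m] [Fintype n] [DecidableEq m]
    (Z : Matrix m n ℂ) (hM : (Z * Zᴴ).IsHermitian) (N : ℕ) :
    ∃ Y : Matrix m n ℂ,
      Y.rank ≤ (Finset.univ.filter fun i : m => ¬ N ≤ (eigenRank i : ℕ)).card ∧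
      frobSq (Z - Y) = tailSum hM N := by
  obtain ⟨U, hU, hU', hD⟩ := exists_unitary_diagonalization hM
  let a : m → ℝ := fun i => if N ≤ (eigenRank i : ℕ) then 1 else 0
  let b : m → ℂ := fun i => if N ≤ (eigenRank i : ℕ) then 0 else 1
  refine ⟨U * diagonal b * Uᴴ * Z, ?_, ?_⟩
  · calc _ ≤ (U * diagonal b * Uᴴ).rank := rank_mul_le_left _ _
      _ ≤ (U * diagonal b).rank := rank_mul_le_left _ _
      _ ≤ (diagonal b).rank := rank_mul_le_right _ _
      _ ≤ _ := by
        rw [rank_diagonal, Fintype.card_subtype]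
        exact Finset.card_le_card fun i => by simp [b]
  · have hsub : Z - U * diagonal b * Uᴴ * Z = U * diagonal (fun i => (a i : ℂ)) * Uᴴ * Z := by
      have : (1 : Matrix m m ℂ) =
          U * diagonal (fun i => (a i : ℂ)) * Uᴴ + U * diagonal b * Uᴴ := by
        rw [← add_mul, ← mul_add, diagonal_add]
        have : (fun i => (a i : ℂ) + b i) = fun _ => 1 := by
          ext i
          by_cases h : N ≤ (eigenRank i : ℕ) <;> simp [a, b, h]
        rw [this, diagonal_one, Matrix.mul_one, hU']
      rw [sub_eq_iff_eq_add, ← Matrix.add_mul, ← this, Matrix.one_mul]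
    have hprod : U * diagonal (fun i => (a i : ℂ)) * Uᴴ * (Z * Zᴴ) =
        U * diagonal (fun i => (a i * hM.eigenvalues i : ℂ)) * Uᴴ :=
      (congrArg _ hD).trans (unitary_conj_diagonal_mul hU _ _)
    rw [hsub, frobSq, conjTranspose_mul, unitary_conj_diagonal_conjTranspose, Matrix.mul_assoc,
      ← Matrix.mul_assoc Z, ← Matrix.mul_assoc, hprod, unitary_conj_diagonal_mul hU,
      trace_unitary_conj_diagonal hU, Complex.re_sum, tailSum]
    refine Finset.sum_congr rfl fun i _ => ?_
    by_cases h : N ≤ (eigenRank i : ℕ) <;> simp [a, h]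

lemma sum_mul_nonneg_of_tail_nonneg {d : ℕ} (w c : Fin d → ℝ) (hw : Monotone w)
    (hw0 : ∀ i, 0 ≤ w i) (hc : ∀ N : ℕ, 0 ≤ ∑ i : Fin d, if N ≤ (i : ℕ) then c i else 0) :
    0 ≤ ∑ i, w i * c i := by
  induction d with
  | zero => simp
  | succ d ih =>
    have h := ih (fun i => w i.succ - w 0) (fun i => c i.succ)
      (fun i j hij => sub_le_sub_right (hw (Fin.succ_le_succ_iff.mpr hij)) _)
      (fun i => sub_nonneg.mpr (hw (Fin.zero_le _)))
      (fun N => by simpa [Fin.sum_univ_succ] using hc (N + 1))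
    have h0 := mul_nonneg (hw0 0) (hc 0)
    simp only [Nat.zero_le, if_true] at h0
    rw [Fin.sum_univ_succ] at h0 ⊢
    simp only [sub_mul, Finset.sum_sub_distrib, ← Finset.mul_sum] at h
    linarith

lemma sum_mul_le_of_tail_le {n : Type*} [Fintype n] [DecidableEq n] (w a b : n → ℝ)
    (hw : ∀ i j : n, eigenRank i ≤ eigenRank j → w i ≤ w j) (hw0 : ∀ i, 0 ≤ w i)
    (h : ∀ N : ℕ, ∑ i, (if N ≤ (eigenRank i : ℕ) then a i else 0) ≤
      ∑ i, if N ≤ (eigenRank i : ℕ) then b i else 0) :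
    ∑ i, w i * a i ≤ ∑ i, w i * b i := by
  let e : Fin (Fintype.card n) ≃ n := Fintype.equivOfCardEq (Fintype.card_fin _)
  have he : ∀ i, eigenRank (e i) = i := e.symm_apply_apply
  have key := sum_mul_nonneg_of_tail_nonneg (w ∘ e) (fun i => b (e i) - a (e i))
    (fun i j hij => hw _ _ (by rwa [he, he])) (fun i => hw0 _) (fun N => by
      have hN := h N
      rw [← e.sum_comp, ← e.sum_comp (fun i => if N ≤ (eigenRank i : ℕ) then b i else 0)] at hN
      simp only [he] at hN
      rw [← sub_nonneg, ← Finset.sum_sub_distrib] at hN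
      refine hN.trans_eq (Finset.sum_congr rfl fun i _ => ?_)
      split_ifs <;> simp)
  simp only [Function.comp_apply, mul_sub, Finset.sum_sub_distrib] at key
  rw [e.sum_comp (fun i => w i * b i), e.sum_comp (fun i => w i * a i)] at key
  linarith

/-- Gibbs' inequality. -/
lemma neg_sum_mul_log_le {n : Type*} [Fintype n] (s q : n → ℝ) (hs : ∀ i, 0 ≤ s i)
    (hq : ∀ i, 0 < q i) (hsum : ∑ i, q i ≤ ∑ i, s i) :
    -∑ i, s i * Real.log (s i) ≤ ∑ i, -Real.log (q i) * s i := by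
  have hterm : ∀ i, s i - q i ≤ -Real.log (q i) * s i + s i * Real.log (s i) := by
    intro i
    rcases (hs i).eq_or_lt with h | h
    · simp [← h, (hq i).le]
    · have := Real.log_le_sub_one_of_pos (div_pos (hq i) h)
      rw [Real.log_div (hq i).ne' h.ne'] at this
      have := mul_le_mul_of_nonneg_left this h.le
      rw [mul_sub, mul_sub, mul_div_cancel₀ _ h.ne'] at this
      linarith
  have h := Finset.sum_le_sum fun i (_ : i ∈ Finset.univ) => hterm i
  rw [Finset.sum_sub_distrib, Finset.sum_add_distrib] at h
  linarith

/-- If the `p`-averaged tail sums of the probability vectors `s k` are at most those of the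
decreasing probability vector `l`, then their average Shannon entropy is at most that of `l`. -/
lemma average_entropy_le_of_tail_le {n κ : Type*} [Fintype n] [DecidableEq n] (T : Finset κ)
    (p : κ → ℝ) (hp : ∀ k ∈ T, 0 ≤ p k) (s : κ → n → ℝ) (l : n → ℝ)
    (hs : ∀ k ∈ T, ∀ i, 0 ≤ s k i) (hs1 : ∀ k ∈ T, ∑ i, s k i = 1)
    (hl : ∀ i, 0 ≤ l i) (hl1 : ∑ i, l i = 1)
    (hanti : ∀ i j : n, eigenRank i ≤ eigenRank j → l j ≤ l i)
    (h : ∀ N : ℕ, ∑ k ∈ T, p k * ∑ i, (if N ≤ (eigenRank i : ℕ) then s k i else 0) ≤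
      ∑ i, if N ≤ (eigenRank i : ℕ) then l i else 0) :
    ∑ k ∈ T, p k * (-∑ i, s k i * Real.log (s k i)) ≤ -∑ i, l i * Real.log (l i) := by
  have hd : (0 : ℝ) < Fintype.card n := by
    rcases isEmpty_or_nonempty n with hn | hn
    · simp at hl1
    · exact_mod_cast Fintype.card_pos
  refine le_of_forall_pos_le_add fun δ hδ => ?_
  obtain ⟨ε, hε, rfl⟩ : ∃ ε : ℝ, 0 < ε ∧ δ = Fintype.card n * ε :=
    ⟨δ / Fintype.card n, div_pos hδ hd, (mul_div_cancel₀ _ hd.ne').symm⟩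
  have hC : 0 < 1 + Fintype.card n * ε := by positivity
  let q : n → ℝ := fun i => (l i + ε) / (1 + Fintype.card n * ε)
  have hq : ∀ i, 0 < q i := fun i => div_pos (add_pos_of_nonneg_of_pos (hl i) hε) hC
  have hq1 : ∑ i, q i = 1 := by
    rw [← Finset.sum_div, Finset.sum_add_distrib, hl1]
    simp [hC.ne']
  calc ∑ k ∈ T, p k * (-∑ i, s k i * Real.log (s k i))
      ≤ ∑ k ∈ T, p k * ∑ i, -Real.log (q i) * s k i :=
        Finset.sum_le_sum fun k hk => mul_le_mul_of_nonneg_left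
          (neg_sum_mul_log_le _ _ (hs k hk) hq (by rw [hq1, hs1 k hk])) (hp k hk)
    _ = ∑ i, -Real.log (q i) * ∑ k ∈ T, p k * s k i := by
        simp only [Finset.mul_sum]
        rw [Finset.sum_comm]
        exact Finset.sum_congr rfl fun i _ => Finset.sum_congr rfl fun k _ => by ring
    _ ≤ ∑ i, -Real.log (q i) * l i := by
        refine sum_mul_le_of_tail_le _ _ _ (fun i j hij => ?_) (fun i => ?_) (fun N => ?_)
        · refine neg_le_neg (Real.log_le_log (hq j) ?_)
          exact div_le_div_of_nonneg_right (by linarith [hanti i j hij]) hC.le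
        · refine neg_nonneg.mpr (Real.log_nonpos (hq i).le ?_)
          rw [← hq1]
          exact Finset.single_le_sum (fun j _ => (hq j).le) (Finset.mem_univ i)
        · refine le_trans (le_of_eq ?_) (h N)
          simp only [Finset.mul_sum, mul_ite, mul_zero]
          rw [Finset.sum_comm]
          refine Finset.sum_congr rfl fun i _ => ?_
          split_ifs <;> simp
    _ ≤ ∑ i, (-(l i * Real.log (l i)) + l i * (Fintype.card n * ε)) := by
        refine Finset.sum_le_sum fun i _ => ?_
        rcases (hl i).eq_or_lt with h0 | h0
        · simp [← h0]
        · have h1 : Real.log (q i) = Real.log (l i + ε) - Real.log (1 + Fintype.card n * ε) :=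
            Real.log_div (by positivity) hC.ne'
          have h2 := Real.log_le_log h0 (by linarith : l i ≤ l i + ε)
          have h3 := Real.log_le_sub_one_of_pos hC
          rw [h1]
          nlinarith
    _ = _ := by rw [Finset.sum_add_distrib, Finset.sum_neg_distrib, ← Finset.sum_mul, hl1, one_mul]

lemma frobSq_eq_star_vec_dotProduct {m n : Type*} [Fintype m] [Fintype n] (Z : Matrix m n ℂ) :
    frobSq Z = (star (vec Z) ⬝ᵥ vec Z).re := by
  rw [star_vec_dotProduct_vec, frobSq, trace_mul_comm]

/-- A product-Kraus family satisfying the completeness relation preserves the total squared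
Frobenius norm. -/
lemma sum_frobSq_kraus {m n κ : Type*} [Fintype m] [Fintype n] [DecidableEq m] [DecidableEq n]
    [Fintype κ] (F : κ → Matrix n n ℂ) (G : κ → Matrix m m ℂ)
    (hcomp : ∑ k, (F k ⊗ₖ G k)ᴴ * (F k ⊗ₖ G k) = 1) (Z : Matrix m n ℂ) :
    ∑ k, frobSq (G k * Z * (F k)ᵀ) = frobSq Z := by
  have h : ∀ k, frobSq (G k * Z * (F k)ᵀ) =
      (star (vec Z) ⬝ᵥ (((F k ⊗ₖ G k)ᴴ * (F k ⊗ₖ G k)) *ᵥ vec Z)).re := by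
    intro k
    rw [frobSq_eq_star_vec_dotProduct, ← kronecker_mulVec_vec, star_mulVec, ← mulVec_mulVec,
      dotProduct_mulVec (star (vec Z))]
  simp only [h]
  rw [← Complex.re_sum, ← dotProduct_sum, ← sum_mulVec, hcomp, one_mulVec,
    frobSq_eq_star_vec_dotProduct]

lemma ptraceA_vecMulVec_vec {A B : Type*} [Fintype A] (Z : Matrix B A ℂ) :
    ptraceA (vecMulVec (vec Z) (star (vec Z))) = Z * Zᴴ := by
  ext i j
  simp [ptraceA, vecMulVec_apply, mul_apply, vec]

lemma ptraceA_smul {A B : Type*} [Fintype A] (c : ℝ) (M : Matrix (A × B) (A × B) ℂ) :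
    ptraceA (c • M) = c • ptraceA M := by
  ext i j
  simp [ptraceA, Finset.smul_sum]

lemma mul_vecMulVec_star_mul_conjTranspose {n : Type*} [Fintype n] (L : Matrix n n ℂ)
    (v : n → ℂ) :
    L * vecMulVec v (star v) * Lᴴ = vecMulVec (L *ᵥ v) (star (L *ᵥ v)) := by
  rw [mul_vecMulVec, vecMulVec_mul, star_mulVec]

lemma sum_eigenvalues_mul_conjTranspose {m n : Type*} [Fintype m] [Fintype n] [DecidableEq m]
    (Z : Matrix m n ℂ) (hM : (Z * Zᴴ).IsHermitian) : ∑ i, hM.eigenvalues i = frobSq Z := by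
  rw [frobSq, hM.trace_eq_sum_eigenvalues]
  simp

/-- **Average entanglement entropy cannot increase under separable (product-Kraus)
operations on pure states.** With `p_k = tr[(F_k ⊗ G_k) ρ (F_k ⊗ G_k)ᴴ]` and
`σ^{(k)} = (F_k ⊗ G_k) ρ (F_k ⊗ G_k)ᴴ / p_k`, one has
`Σ_{k : p_k > 0} p_k S(tr_A σ^{(k)}) ≤ S(tr_A ρ)`. -/
theorem average_entanglement_entropy_nonincreasing
    (dA dB : ℕ) (K : Type*) [Fintype K]
    (ψ : Fin dA × Fin dB → ℂ) (hψ : ∑ p, Complex.normSq (ψ p) = 1)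
    (ρ : Matrix (Fin dA × Fin dB) (Fin dA × Fin dB) ℂ)
    (hρ : ρ = Matrix.of fun p q => ψ p * star (ψ q))
    (F : K → Matrix (Fin dA) (Fin dA) ℂ) (G : K → Matrix (Fin dB) (Fin dB) ℂ)
    (hcomp : ∑ k, (F k ⊗ₖ G k)ᴴ * (F k ⊗ₖ G k) = 1)
    (p : K → ℝ) (hp : ∀ k, p k = ((F k ⊗ₖ G k) * ρ * (F k ⊗ₖ G k)ᴴ).trace.re)
    (σ : K → Matrix (Fin dA × Fin dB) (Fin dA × Fin dB) ℂ)
    (hσ : ∀ k, 0 < p k → σ k = (p k)⁻¹ • ((F k ⊗ₖ G k) * ρ * (F k ⊗ₖ G k)ᴴ)) :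
    ∑ k ∈ Finset.univ.filter (fun k => 0 < p k), p k * vN (ptraceA (σ k)) ≤
      vN (ptraceA ρ) := by
  let Z : Matrix (Fin dB) (Fin dA) ℂ := Matrix.of fun b a => ψ (a, b)
  let X : K → Matrix (Fin dB) (Fin dA) ℂ := fun k => G k * Z * (F k)ᵀ
  let V : K → Matrix (Fin dB) (Fin dA) ℂ := fun k => (√(p k))⁻¹ • X k
  have hρZ : ρ = vecMulVec (vec Z) (star (vec Z)) := hρ
  have hout : ∀ k, (F k ⊗ₖ G k) * ρ * (F k ⊗ₖ G k)ᴴ = vecMulVec (vec (X k)) (star (vec (X k))) :=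
    fun k => by rw [hρZ, mul_vecMulVec_star_mul_conjTranspose, kronecker_mulVec_vec]
  have hpX : ∀ k, p k = frobSq (X k) := by
    intro k
    rw [hp, hout, trace_vecMulVec, dotProduct_comm, frobSq_eq_star_vec_dotProduct]
  have hp0 : ∀ k, 0 ≤ p k := fun k => by rw [hpX]; exact frobSq_nonneg _
  have hZ1 : frobSq Z = 1 := by
    rw [← hψ, frobSq_eq_star_vec_dotProduct, dotProduct, Complex.re_sum]
    refine Finset.sum_congr rfl fun x _ => ?_
    rw [Pi.star_apply, Complex.star_def, mul_comm, Complex.mul_conj, Complex.ofReal_re]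
    rfl
  have hscale : ∀ k, 0 < p k → ∀ D : Matrix (Fin dB) (Fin dA) ℂ,
      p k * frobSq ((√(p k))⁻¹ • D) = frobSq D := by
    intro k hk D
    rw [frobSq_smul, inv_pow, Real.sq_sqrt hk.le, mul_inv_cancel_left₀ hk.ne']
  have hσV : ∀ k, 0 < p k → ptraceA (σ k) = V k * (V k)ᴴ := by
    intro k hk
    rw [hσ k hk, hout, ptraceA_smul, ptraceA_vecMulVec_vec]
    simp [V, conjTranspose_smul, smul_smul, ← mul_inv, Real.mul_self_sqrt hk.le]
  have hVH : ∀ k, (V k * (V k)ᴴ).IsHermitian := fun k => isHermitian_mul_conjTranspose_self _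
  have hZH : (Z * Zᴴ).IsHermitian := isHermitian_mul_conjTranspose_self _
  have hvN : ∀ {M : Matrix (Fin dB) (Fin dB) ℂ} (hM : M.IsHermitian),
      vN M = -∑ i, hM.eigenvalues i * Real.log (hM.eigenvalues i) := fun hM => dif_pos hM
  rw [hρZ, ptraceA_vecMulVec_vec, hvN hZH]
  rw [Finset.sum_congr rfl fun k hk => by
    rw [hσV k (Finset.mem_filter.mp hk).2, hvN (hVH k)]]
  refine average_entropy_le_of_tail_le _ p (fun k _ => hp0 k)
    (fun k => (hVH k).eigenvalues) _
    (fun k _ => (posSemidef_self_mul_conjTranspose (V k)).eigenvalues_nonneg) (fun k hk => ?_)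
    (posSemidef_self_mul_conjTranspose Z).eigenvalues_nonneg ?_
    (fun i j hij => eigenvalues_le_of_eigenRank_le hZH hij) (fun N => ?_)
  · have hk := (Finset.mem_filter.mp hk).2
    rw [sum_eigenvalues_mul_conjTranspose]
    exact mul_left_cancel₀ hk.ne' (by rw [hscale k hk, mul_one, hpX])
  · rw [sum_eigenvalues_mul_conjTranspose, hZ1]
  · obtain ⟨Y, hY, hYtail⟩ := exists_rank_le_frobSq_sub_eq_tailSum Z hZH N
    change ∑ k ∈ _, p k * tailSum (hVH k) N ≤ tailSum hZH N
    rw [← hYtail, ← sum_frobSq_kraus F G hcomp]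
    refine (Finset.sum_le_sum fun k hk => ?_).trans (Finset.sum_le_sum_of_subset_of_nonneg
      (Finset.filter_subset (fun k => 0 < p k) _) fun k _ _ => frobSq_nonneg _)
    have hk := (Finset.mem_filter.mp hk).2
    rw [← hscale k hk, Matrix.mul_sub, Matrix.sub_mul, smul_sub]
    refine mul_le_mul_of_nonneg_left (tailSum_le_frobSq_sub _ _ (hVH k) N ?_) (hp0 k)
    rw [← Matrix.smul_mul, ← Matrix.smul_mul]
    exact (rank_mul_le_left _ _).trans ((rank_mul_le_right _ _).trans hY)
end
end
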